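/- arXiv:2404.02021 — 2 statements merged into one kernel-verified Lean document; each statement's English description precedes it below -/
import Mathlib

section
/- For every nonempty 3-graph H with m_pair(H) ≥ 1/2, there exist a constant c > 0 and an integer n_0 (both depending only on H) such that for all n ≥ n_0, the Ramsey number satisfies r(H, K_{n,n,n}^(3)) ≥ 2^{c n log n} (log denotes the natural logarithm). -/
/-- A 3-uniform hypergraph on a finite subset of `ℕ`. -/
structure ThreeGraph where
  verts : Finset ℕ
  edges : Finset (Finset ℕ)
  card_eq : ∀ e ∈ edges, e.card = 3
  subset_verts : ∀ e ∈ edges, e ⊆ verts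

/-- `χ` (on 3-element subsets of `{0, …, N-1}`) contains a copy of `H` in color `c`
(`true` = red, `false` = blue). -/
def hasMonoCopy (N : ℕ) (χ : Finset ℕ → Bool) (H : ThreeGraph) (c : Bool) : Prop :=
  ∃ φ : ℕ → ℕ, Set.InjOn φ ↑H.verts ∧ (∀ v ∈ H.verts, φ v < N) ∧
    ∀ e ∈ H.edges, χ (e.image φ) = c

/-- The Ramsey number `r(G, H)`: the least `N` such that every red/blue coloring of the
triples of an `N`-element set contains a red copy of `G` or a blue copy of `H`. -/
noncomputable def ramsey (G H : ThreeGraph) : ℕ :=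
  sInf {N : ℕ | ∀ χ : Finset ℕ → Bool,
    hasMonoCopy N χ G true ∨ hasMonoCopy N χ H false}

/-- The complete tripartite 3-graph `K_{a,b,c}^{(3)}`. -/
def tripartite (a b c : ℕ) : ThreeGraph where
  verts := Finset.range (a + b + c)
  edges := ((Finset.range (a + b + c)).powersetCard 3).filter (fun e =>
    (e.filter (fun x => x < a)).card = 1 ∧
    (e.filter (fun x => a ≤ x ∧ x < a + b)).card = 1 ∧
    (e.filter (fun x => a + b ≤ x)).card = 1)
  card_eq := fun e he => (Finset.mem_powersetCard.mp (Finset.mem_filter.mp he).1).2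
  subset_verts := fun e he => (Finset.mem_powersetCard.mp (Finset.mem_filter.mp he).1).1

/-- The complete 3-graph `K_n^{(3)}`. -/
def completeTG (n : ℕ) : ThreeGraph where
  verts := Finset.range n
  edges := (Finset.range n).powersetCard 3
  card_eq := fun e he => (Finset.mem_powersetCard.mp he).2
  subset_verts := fun e he => (Finset.mem_powersetCard.mp he).1

/-- The shadow of a set of 3-edges: all 2-element subsets of its edges. -/
def shadowOf (E : Finset (Finset ℕ)) : Finset (Finset ℕ) :=
  E.biUnion (fun e => e.powersetCard 2)

/-- An oriented 3-graph (given by its edge set of ordered triples): it contains at most one of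
the six coordinate permutations of any ordered triple and no triple with a repeated
coordinate. -/
def Oriented (E : Set (ℕ × ℕ × ℕ)) : Prop :=
  ∀ a b c : ℕ, (a, b, c) ∈ E →
    (a ≠ b ∧ b ≠ c ∧ a ≠ c) ∧
    (a, c, b) ∉ E ∧ (b, a, c) ∉ E ∧ (b, c, a) ∉ E ∧ (c, a, b) ∉ E ∧ (c, b, a) ∉ E

/-- `f` is a pair homomorphism from `H`, ordered by the (injective on `V(H)`) function `ord`,
to the oriented 3-graph with edge set `E`. -/
def IsPairHom (H : ThreeGraph) (ord : ℕ → ℕ) (E : Set (ℕ × ℕ × ℕ))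
    (f : Finset ℕ → ℕ) : Prop :=
  Set.InjOn ord ↑H.verts ∧
  ∀ e ∈ H.edges, ∀ u v w : ℕ, e = {u, v, w} → ord u < ord v → ord v < ord w →
    (f {u, v} ≠ f {v, w} ∧ f {v, w} ≠ f {u, w} ∧ f {u, v} ≠ f {u, w}) ∧
    (f {u, v}, f {v, w}, f {u, w}) ∈ E

/-- `v(f(H'))` for the subhypergraph with edge set `E'`: the number of vertices of the image,
i.e. the size of the image of the shadow of `E'` under `f`. -/
def imageVerts (f : Finset ℕ → ℕ) (E' : Finset (Finset ℕ)) : ℕ :=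
  ((shadowOf E').image f).card

/-- `e(f(H'))` for the subhypergraph with edge set `E'`: the number of distinct image triples. -/
noncomputable def imageEdges (ord : ℕ → ℕ) (f : Finset ℕ → ℕ)
    (E' : Finset (Finset ℕ)) : ℕ :=
  Set.ncard {p : ℕ × ℕ × ℕ | ∃ e ∈ E', ∃ u v w : ℕ,
    e = ({u, v, w} : Finset ℕ) ∧ ord u < ord v ∧ ord v < ord w ∧
    p = (f {u, v}, f {v, w}, f {u, w})}

/-- The pair density `m_pair(H)`: the minimum, over all orderings of `V(H)` and all pair
homomorphisms `f` from `H` to any oriented 3-graph, of the maximum over all nonempty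
subhypergraphs `H' ⊆ H` of `e(f(H')) / v(f(H'))`. -/
noncomputable def mpair (H : ThreeGraph) : ℝ :=
  sInf {q : ℝ | ∃ (ord : ℕ → ℕ) (E : Set (ℕ × ℕ × ℕ)) (f : Finset ℕ → ℕ),
    Oriented E ∧ IsPairHom H ord E f ∧
    q = sSup {r : ℝ | ∃ E' : Finset (Finset ℕ), E' ⊆ H.edges ∧ E'.Nonempty ∧
      r = (imageEdges ord f E' : ℝ) / (imageVerts f E' : ℝ)}}

/-- The set of 3-edges `E` contains a Berge cycle: `t ≥ 2` distinct vertices and `t` distinct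
edges with `v i, v (i+1) ∈ e i` cyclically. -/
def HasBergeCycle (E : Set (Finset ℕ)) : Prop :=
  ∃ t : ℕ, 2 ≤ t ∧ ∃ (v : ZMod t → ℕ) (e : ZMod t → Finset ℕ),
    Function.Injective v ∧ Function.Injective e ∧
    ∀ i : ZMod t, e i ∈ E ∧ v i ∈ e i ∧ v (i + 1) ∈ e i

/-- `H` is avoidable: for every ordering and every pair homomorphism `f` from `H` to an
oriented 3-graph, the 3-graph of underlying vertex sets of the image edges has a Berge cycle. -/
def Avoidable (H : ThreeGraph) : Prop :=
  ∀ (ord : ℕ → ℕ) (E : Set (ℕ × ℕ × ℕ)) (f : Finset ℕ → ℕ),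
    Oriented E → IsPairHom H ord E f →
    HasBergeCycle {s : Finset ℕ | ∃ e ∈ H.edges, ∃ u v w : ℕ,
      e = ({u, v, w} : Finset ℕ) ∧ ord u < ord v ∧ ord v < ord w ∧
      s = ({f {u, v}, f {v, w}, f {u, w}} : Finset ℕ)}

/-- A linear 3-graph: any two distinct edges share at most one vertex. -/
def LinearTG (F : ThreeGraph) : Prop :=
  ∀ e₁ ∈ F.edges, ∀ e₂ ∈ F.edges, e₁ ≠ e₂ → (e₁ ∩ e₂).card ≤ 1

/-! ### Finiteness of the Ramsey number -/

lemma ultra_bool (U : Ultrafilter ℕ) (p : ℕ → Bool) : ∃ c : Bool, ∀ᶠ x in (U : Filter ℕ), p x = c := by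
  by_cases h : ∀ᶠ x in (U : Filter ℕ), p x = true
  · exact ⟨true, h⟩
  · refine ⟨false, ?_⟩
    have := Ultrafilter.eventually_not.2 h
    filter_upwards [this] with x hx
    simpa using hx

lemma ultra_gt (t : ℕ) : ∀ᶠ x in (Filter.hyperfilter ℕ : Filter ℕ), t < x := by
  have h : ∀ᶠ x in (Filter.cofinite : Filter ℕ), t < x := by
    rw [Nat.cofinite_eq_atTop]; exact Filter.eventually_gt_atTop t
  exact Filter.hyperfilter_le_cofinite h

lemma homogeneous_seq (χ : Finset ℕ → Bool) :
    ∃ c : Bool, ∀ T : ℕ, ∃ x : ℕ → ℕ, (∀ i j, i < j → j < T → x i < x j) ∧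
      ∀ i j k, i < j → j < k → k < T → χ {x i, x j, x k} = c := by
  set U := Filter.hyperfilter ℕ with hU
  have h2 : ∀ u v : ℕ, ∃ c : Bool, ∀ᶠ w in (U : Filter ℕ), χ {u, v, w} = c :=
    fun u v => ultra_bool U _
  choose c2 hc2 using h2
  have h1 : ∀ u : ℕ, ∃ c : Bool, ∀ᶠ v in (U : Filter ℕ), c2 u v = c := fun u => ultra_bool U _
  choose c1 hc1 using h1
  obtain ⟨c, hc⟩ := ultra_bool U c1
  refine ⟨c, fun T => ?_⟩
  suffices h : ∃ x : ℕ → ℕ, (∀ i j, i < j → j < T → x i < x j) ∧ (∀ i, i < T → c1 (x i) = c) ∧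
      (∀ i j, i < j → j < T → c2 (x i) (x j) = c) ∧
      ∀ i j k, i < j → j < k → k < T → χ {x i, x j, x k} = c by
    obtain ⟨x, h1, -, -, h4⟩ := h
    exact ⟨x, h1, h4⟩
  induction T with
  | zero => exact ⟨id, by simp⟩
  | succ T ih =>
    obtain ⟨x, hx1, hx2, hx3, hx4⟩ := ih
    have e1 : ∀ᶠ y in (U : Filter ℕ), ∀ i ∈ Finset.range T, x i < y :=
      (Filter.eventually_all_finset _).2 fun i _ => ultra_gt _
    have e2 : ∀ᶠ y in (U : Filter ℕ), ∀ i ∈ Finset.range T, c2 (x i) y = c :=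
      (Filter.eventually_all_finset _).2 fun i hi => by
        have := hc1 (x i)
        rw [hx2 i (Finset.mem_range.1 hi)] at this
        exact this
    have e3 : ∀ᶠ y in (U : Filter ℕ), ∀ i ∈ Finset.range T, ∀ j ∈ Finset.range T,
        i < j → χ {x i, x j, y} = c :=
      (Filter.eventually_all_finset _).2 fun i hi => (Filter.eventually_all_finset _).2 fun j hj => by
        by_cases hij : i < j
        · have := hc2 (x i) (x j)
          rw [hx3 i j hij (Finset.mem_range.1 hj)] at this
          filter_upwards [this] with y hy _ using hy
        · exact Filter.Eventually.of_forall fun y h => absurd h hij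
    obtain ⟨y, y0, y1, y2, y3⟩ := (hc.and (e1.and (e2.and e3))).exists
    simp only [Finset.mem_range] at y1 y2 y3
    refine ⟨fun i => if i < T then x i else y, ?_, ?_, ?_, ?_⟩
    · intro i j hij hj
      have hi : i < T := by omega
      by_cases h : j < T <;> simp [hi, h] 
      · exact hx1 i j hij h
      · exact y1 i hi
    · intro i hi
      by_cases h : i < T <;> simp [h]
      · exact hx2 i h
      · exact y0
    · intro i j hij hj
      have hi : i < T := by omega
      by_cases h : j < T <;> simp [hi, h] 
      · exact hx3 i j hij h
      · exact y2 i hi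
    · intro i j k hij hjk hk
      have hi : i < T := by omega
      have hj : j < T := by omega
      by_cases h : k < T <;> simp [hi, hj, h] 
      · exact hx4 i j k hij hjk h
      · exact y3 i hi j hj hij

lemma card_three_sorted (e : Finset ℕ) (he : e.card = 3) :
    ∃ a b c, a < b ∧ b < c ∧ e = {a, b, c} := by
  obtain ⟨x, y, z, hxy, hxz, hyz, rfl⟩ := Finset.card_eq_three.1 he
  rcases lt_or_gt_of_ne hxy with h1 | h1 <;> rcases lt_or_gt_of_ne hxz with h2 | h2 <;>
    rcases lt_or_gt_of_ne hyz with h3 | h3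
  · exact ⟨x, y, z, h1, h3, rfl⟩
  · exact ⟨x, z, y, h2, h3, by ext; simp; tauto⟩
  · omega
  · exact ⟨z, x, y, h2, h1, by ext; simp; tauto⟩
  · exact ⟨y, x, z, h1, h2, by ext; simp; tauto⟩
  · omega
  · exact ⟨y, z, x, h3, h2, by ext; simp; tauto⟩
  · exact ⟨z, y, x, h3, h1, by ext; simp; tauto⟩

lemma ramsey_set_nonempty (G H : ThreeGraph) : {N : ℕ | ∀ χ : Finset ℕ → Bool,
    hasMonoCopy N χ G true ∨ hasMonoCopy N χ H false}.Nonempty := by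
  by_contra hcon
  rw [Set.not_nonempty_iff_eq_empty] at hcon
  have hbad : ∀ N : ℕ, ∃ χ : Finset ℕ → Bool,
      ¬ hasMonoCopy N χ G true ∧ ¬ hasMonoCopy N χ H false := by
    intro N
    have : N ∉ {N : ℕ | ∀ χ : Finset ℕ → Bool,
      hasMonoCopy N χ G true ∨ hasMonoCopy N χ H false} := by rw [hcon]; simp
    simpa [not_or] using this
  choose χ hG hH using hbad
  set U := Filter.hyperfilter ℕ
  have hlim : ∀ e : Finset ℕ, ∃ c, ∀ᶠ N in (U : Filter ℕ), χ N e = c := fun e => ultra_bool U _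
  choose χ' hχ' using hlim
  obtain ⟨c, hc⟩ := homogeneous_seq χ'
  have key : ∀ F : ThreeGraph, ∀ᶠ N in (U : Filter ℕ), hasMonoCopy N (χ N) F c := by
    intro F
    obtain ⟨T, hT⟩ : ∃ T, ∀ v ∈ F.verts, v < T :=
      ⟨F.verts.sup id + 1, fun v hv => Nat.lt_succ_of_le (Finset.le_sup (f := id) hv)⟩
    obtain ⟨x, hx1, hx2⟩ := hc T
    have e1 : ∀ᶠ N in (U : Filter ℕ), ∀ v ∈ F.verts, x v < N :=
      (Filter.eventually_all_finset _).2 fun i _ => ultra_gt _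
    have e2 : ∀ᶠ N in (U : Filter ℕ), ∀ e ∈ F.edges, χ N (e.image x) = c :=
      (Filter.eventually_all_finset _).2 fun e he => by
        obtain ⟨u, v, w, huv, hvw, rfl⟩ := card_three_sorted e (F.card_eq e he)
        have hw : w < T := hT w (F.subset_verts _ he (by simp))
        have := hχ' (({u, v, w} : Finset ℕ).image x)
        have h2 : ({u, v, w} : Finset ℕ).image x = {x u, x v, x w} := by
          simp [Finset.image_insert]
        rw [h2, hx2 u v w huv hvw hw] at this
        rw [h2]; exact this
    filter_upwards [e1, e2] with N h1 h2
    refine ⟨x, ?_, h1, h2⟩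
    intro u hu v hv huv
    rcases lt_trichotomy u v with h | h | h
    · exact absurd huv (hx1 u v h (hT v hv)).ne
    · exact h
    · exact absurd huv (hx1 v u h (hT u hu)).ne'
  cases c with
  | true => obtain ⟨N, hN⟩ := (key G).exists; exact hG N hN
  | false => obtain ⟨N, hN⟩ := (key H).exists; exact hH N hN

lemma lt_ramsey (G H : ThreeGraph) (N : ℕ) (χ : Finset ℕ → Bool)
    (h1 : ¬ hasMonoCopy N χ G true) (h2 : ¬ hasMonoCopy N χ H false) : N < ramsey G H := by
  by_contra hle
  push Not at hle
  have hmem := Nat.sInf_mem (ramsey_set_nonempty G H)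
  have mono : ∀ F c, hasMonoCopy (ramsey G H) χ F c → hasMonoCopy N χ F c := by
    rintro F c ⟨φ, a, b, d⟩
    exact ⟨φ, a, fun v hv => (b v hv).trans_le hle, d⟩
  rcases hmem χ with h | h
  · exact h1 (mono _ _ h)
  · exact h2 (mono _ _ h)

/-! ### Counting lemmas -/

section Counting
open Finset Classical

/-- Functions taking at least `j` times a value in a small set are rare. -/
lemma count_small {I V : Type*} [Fintype I] [Fintype V]
    [DecidableEq I] (q j : ℕ) (Bd : I → Finset V) (P : (I → V) → Prop) [DecidablePred P]
    (hP : ∀ ξ, P ξ → ∃ B' : Finset I, B'.card = j ∧ ∀ b ∈ B', (Bd b).card * q ≤ Fintype.card V ∧ ξ b ∈ Bd b) :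
    (univ.filter P).card * q ^ j ≤ 2 ^ Fintype.card I * Fintype.card V ^ Fintype.card I := by
  set Fam : Finset (Finset I) := univ.filter (fun B' => B'.card = j ∧ ∀ b ∈ B', (Bd b).card * q ≤ Fintype.card V)
  have hsub : univ.filter P ⊆ Fam.biUnion (fun B' => Fintype.piFinset (fun b => if b ∈ B' then Bd b else univ)) := by
    intro ξ hξ
    obtain ⟨B', h1, h2⟩ := hP ξ (mem_filter.1 hξ).2
    rw [mem_biUnion]
    refine ⟨B', by simp [Fam, h1]; exact fun b hb => (h2 b hb).1, ?_⟩
    rw [Fintype.mem_piFinset]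
    intro b
    split_ifs with h
    · exact (h2 b h).2
    · simp
  have hone : ∀ B' ∈ Fam, (Fintype.piFinset (fun b => if b ∈ B' then Bd b else univ)).card * q ^ j
      ≤ Fintype.card V ^ Fintype.card I := by
    intro B' hB'
    obtain ⟨h1, h2⟩ := (mem_filter.1 hB').2
    rw [Fintype.card_piFinset]
    have : q ^ j = ∏ b : I, (if b ∈ B' then q else 1) := by
      rw [prod_ite_mem, univ_inter, prod_const, h1]
    rw [this, ← prod_mul_distrib]
    calc _ ≤ ∏ _b : I, Fintype.card V := by
          apply prod_le_prod' 
          intro b _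
          split_ifs with h
          · exact h2 b h
          · simp
      _ = _ := by simp
  calc (univ.filter P).card * q ^ j ≤ (∑ B' ∈ Fam, (Fintype.piFinset (fun b => if b ∈ B' then Bd b else univ)).card) * q ^ j :=
        Nat.mul_le_mul_right _ ((card_le_card hsub).trans card_biUnion_le)
    _ = ∑ B' ∈ Fam, (Fintype.piFinset (fun b => if b ∈ B' then Bd b else univ)).card * q ^ j := by rw [sum_mul]
    _ ≤ ∑ _B' ∈ Fam, Fintype.card V ^ Fintype.card I := sum_le_sum hone
    _ = Fam.card * Fintype.card V ^ Fintype.card I := by simp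
    _ ≤ _ := by
      apply Nat.mul_le_mul_right
      calc Fam.card ≤ (univ : Finset (Finset I)).card := card_le_card (filter_subset _ _)
        _ = _ := by simp

/-- Functions whose values off `S` lie in a small set determined by the values on `S`. -/
lemma count_dep {A Ω : Type*} [Fintype A] [Fintype Ω] [DecidableEq A] (S : Finset A)
    (Q : (A → Ω) → Finset Ω) (hQ : ∀ w w' : A → Ω, (∀ a ∈ S, w a = w' a) → Q w = Q w')
    (β : ℕ) (P : (A → Ω) → Prop) [DecidablePred P]
    (hP : ∀ w, P w → (Q w).card ≤ β ∧ ∀ a, a ∉ S → w a ∈ Q w) :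
    (univ.filter P).card ≤ Fintype.card Ω ^ S.card * β ^ (Fintype.card A - S.card) := by
  have := card_le_mul_card_image_of_maps_to (s := univ.filter P)
    (t := (univ : Finset (S → Ω))) (f := fun w a => w a.1) (fun _ _ => mem_univ _)
    (β ^ (Fintype.card A - S.card)) ?_
  · refine this.trans (le_of_eq ?_)
    rw [mul_comm]; simp
  · intro p _
    by_cases hne : ((univ.filter P).filter (fun w => (fun a : S => w a.1) = p)).Nonempty
    · obtain ⟨w0, hw0⟩ := hne
      simp only [mem_filter, mem_univ, true_and] at hw0
      obtain ⟨hw0, hw0p⟩ := hw0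
      have hsub : (univ.filter P).filter (fun w => (fun a : S => w a.1) = p) ⊆
          Fintype.piFinset (fun a => if a ∈ S then {w0 a} else Q w0) := by
        intro w hw
        simp only [mem_filter, mem_univ, true_and] at hw
        obtain ⟨hw, hwp⟩ := hw
        have hag : ∀ a ∈ S, w a = w0 a := by
          intro a ha
          have := congrFun (hwp.trans hw0p.symm) ⟨a, ha⟩
          simpa using this
        rw [Fintype.mem_piFinset]
        intro a
        split_ifs with h
        · simp [hag a h]
        · rw [← hQ w w0 hag]; exact (hP w hw).2 a h
      refine (card_le_card hsub).trans ?_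
      rw [Fintype.card_piFinset]
      have : β ^ (Fintype.card A - S.card) = ∏ a : A, (if a ∈ S then 1 else β) := by
        rw [prod_ite]; simp [← card_compl, filter_not, compl_eq_univ_sdiff]
      rw [this]
      apply prod_le_prod'
      intro a _
      split_ifs
      · simp
      · exact (hP w0 hw0).1
    · rw [not_nonempty_iff_eq_empty.1 hne]; simp

/-- Marginal of the uniform distribution. -/
lemma count_marginal {I J V : Type*} [Fintype I] [Fintype J] [Fintype V]
    [DecidableEq I] [DecidableEq J] (ι : I → J) (hι : Function.Injective ι) (P : (I → V) → Prop)
    [DecidablePred P] [DecidablePred (fun g : J → V => P (g ∘ ι))] :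
    (univ.filter (fun g : J → V => P (g ∘ ι))).card * Fintype.card V ^ Fintype.card I
      ≤ (univ.filter P).card * Fintype.card V ^ Fintype.card J := by
  have hIJ : Fintype.card I ≤ Fintype.card J := Fintype.card_le_of_injective ι hι
  have h1 : (univ.filter (fun g : J → V => P (g ∘ ι))).card ≤
      Fintype.card V ^ (Fintype.card J - Fintype.card I) * (univ.filter P).card := by
    apply card_le_mul_card_image_of_maps_to (f := fun g => g ∘ ι)
    · intro g hg
      simpa using hg
    · intro p _
      have hsub : (univ.filter (fun g : J → V => P (g ∘ ι))).filter (fun g => g ∘ ι = p) ⊆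
          Fintype.piFinset (fun j => if h : ∃ i, ι i = j then {p h.choose} else univ) := by
        intro g hg
        have hg := (mem_filter.1 hg).2
        rw [Fintype.mem_piFinset]
        intro j
        split_ifs with h
        · rw [mem_singleton, ← hg, Function.comp, h.choose_spec]
        · simp
      refine (card_le_card hsub).trans ?_
      rw [Fintype.card_piFinset]
      have h3 : ∀ j : J, (if h : ∃ i, ι i = j then ({p h.choose} : Finset V) else univ).card
          = if j ∈ univ.image ι then 1 else Fintype.card V := by
        intro j
        by_cases h : ∃ i, ι i = j
        · simp [h]
        · simp [h]
      simp_rw [h3]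
      rw [prod_ite]
      simp only [prod_const_one, one_mul, prod_const]
      apply le_of_eq
      congr 1
      rw [filter_not, ← compl_eq_univ_sdiff, card_compl]
      congr 1
      rw [filter_mem_eq_inter, univ_inter, card_image_of_injective _ hι, card_univ]
  calc _ ≤ Fintype.card V ^ (Fintype.card J - Fintype.card I) * (univ.filter P).card * Fintype.card V ^ Fintype.card I :=
        Nat.mul_le_mul_right _ h1
    _ = (univ.filter P).card * (Fintype.card V ^ (Fintype.card J - Fintype.card I) * Fintype.card V ^ Fintype.card I) := by ring
    _ = _ := by rw [← pow_add, Nat.sub_add_cancel hIJ]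

end Counting

/-! ### Blue tripartite patterns are rare -/

section Core
open Finset Classical

lemma count_fst {X Y : Type*} [Fintype X] [Fintype Y] (P : X → Y → Prop)
    [∀ x, DecidablePred (P x)] [DecidablePred (fun p : X × Y => P p.1 p.2)] (c d : ℕ)
    (h : ∀ x, (univ.filter (P x)).card * c ≤ d) :
    (univ.filter (fun p : X × Y => P p.1 p.2)).card * c ≤ Fintype.card X * d := by
  have h1 : (univ.filter (fun p : X × Y => P p.1 p.2)).card = ∑ x : X, (univ.filter (P x)).card := by
    simp only [card_filter]
    rw [← univ_product_univ, sum_product]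
    refine sum_congr rfl fun x _ => sum_congr rfl fun y _ => ?_
    by_cases hP : P x y <;> simp [hP]
  rw [h1, sum_mul]
  calc _ ≤ ∑ _x : X, d := sum_le_sum fun x _ => h x
    _ = _ := by simp

lemma count_fst_only {X Y : Type*} [Fintype X] [Fintype Y] (P : X → Prop)
    [DecidablePred P] [DecidablePred (fun p : X × Y => P p.1)] :
    (univ.filter (fun p : X × Y => P p.1)).card = (univ.filter P).card * Fintype.card Y := by
  have : univ.filter (fun p : X × Y => P p.1) = (univ.filter P) ×ˢ (univ : Finset Y) := by
    ext; simp
  rw [this, card_product, card_univ]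

variable {V : Type*} [Fintype V]

/-- Every box of three sets of size `s` contains an edge. -/
def BoxDense (G : V → V → V → Prop) (s : ℕ) : Prop :=
  ∀ X Y Z : Finset V, s ≤ X.card → s ≤ Y.card → s ≤ Z.card →
    ∃ x ∈ X, ∃ y ∈ Y, ∃ z ∈ Z, G x y z

/-- Number of values removed from the lists `W` by the vectors `ξ`, `ζ`. -/
noncomputable def kills (G : V → V → V → Prop) {k : ℕ} (W : Fin k → Fin k → Finset V)
    (ξ ζ : Fin k → V) : ℕ :=
  ∑ b, ∑ c, ((W b c).filter (fun y => G (ξ b) y (ζ c))).card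

/-- The lists `W` are mostly large. -/
def Rich {k : ℕ} (W : Fin k → Fin k → Finset V) (s : ℕ) : Prop :=
  k ^ 2 < 2 * (univ.filter (fun p : Fin k × Fin k => s ≤ (W p.1 p.2).card)).card

lemma rich_bad (G : V → V → V → Prop) (k κ m q s r : ℕ) (hk : k = 8 * κ)
    (hm : Fintype.card V = m) (hqs : m = s * q) (hrm : r * m ≤ κ) (hmk : m ≤ k)
    (hG : BoxDense G s) (W : Fin k → Fin k → Finset V) (hW : Rich W s) :
    (univ.filter (fun p : (Fin k → V) × (Fin k → V) => kills G W p.1 p.2 < κ * r)).card * q ^ κ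
      ≤ 8 ^ k * m ^ (2 * k) := by
  set Bc : Fin k → Finset (Fin k) := fun c => univ.filter (fun b => s ≤ (W b c).card) with hBc
  set C' : Finset (Fin k) := univ.filter (fun c => 2 * κ ≤ (Bc c).card) with hC'
  have hsum : (univ.filter (fun p : Fin k × Fin k => s ≤ (W p.1 p.2).card)).card = ∑ c, (Bc c).card := by
    simp only [hBc, card_filter]
    rw [← univ_product_univ, sum_product_right]
  have hC'card : 2 * κ ≤ C'.card := by
    have h1 : ∑ c, (Bc c).card ≤ ∑ c : Fin k, ((if c ∈ C' then k else 0) + 2 * κ) := by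
      apply sum_le_sum
      intro c _
      split_ifs with h
      · have : (Bc c).card ≤ k := (card_le_univ _).trans (by simp)
        omega
      · simp only [hC', mem_filter, mem_univ, true_and] at h
        omega
    rw [sum_add_distrib, sum_ite_mem, univ_inter] at h1
    simp only [sum_const, card_univ, Fintype.card_fin, smul_eq_mul] at h1
    unfold Rich at hW
    rw [hsum] at hW
    subst hk
    by_contra hlt
    push Not at hlt
    have : C'.card * (8 * κ) ≤ (2 * κ) * (8 * κ) := Nat.mul_le_mul_right _ hlt.le
    nlinarith
  set few : (Fin k → V) → Fin k → Finset V := fun ξ c =>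
    univ.filter (fun z => ((Bc c).filter (fun b => ∃ y ∈ W b c, G (ξ b) y z)).card < r) with hfew
  have claim1 : ∀ c ∈ C', (univ.filter (fun ξ : Fin k → V => s ≤ (few ξ c).card)).card * q ^ κ ≤
      2 ^ m * (2 ^ k * m ^ k) := by
    intro c hc
    have hc : 2 * κ ≤ (Bc c).card := by simpa [hC'] using hc
    set Fam : Finset (Finset V) := univ.filter (fun Z0 => s ≤ Z0.card)
    have hsub : univ.filter (fun ξ : Fin k → V => s ≤ (few ξ c).card) ⊆
        Fam.biUnion (fun Z0 => univ.filter (fun ξ : Fin k → V => s ≤ Z0.card ∧ few ξ c = Z0)) := by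
      intro ξ hξ
      have hξ := (mem_filter.1 hξ).2
      rw [mem_biUnion]
      exact ⟨few ξ c, by simp [Fam, hξ], by simp [hξ]⟩
    have hone : ∀ Z0 ∈ Fam, (univ.filter (fun ξ : Fin k → V => s ≤ Z0.card ∧ few ξ c = Z0)).card * q ^ κ
        ≤ 2 ^ k * m ^ k := by
      intro Z0 _
      have := count_small (I := Fin k) (V := V) q κ
        (fun b => univ.filter (fun x => ∀ y ∈ W b c, ∀ z ∈ Z0, ¬ G x y z))
        (fun ξ : Fin k → V => s ≤ Z0.card ∧ few ξ c = Z0) ?_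
      · simpa [hm] using this
      · rintro ξ ⟨hZ, hξ⟩
        have hhit : ((Bc c).filter (fun b => ∃ z ∈ Z0, ∃ y ∈ W b c, G (ξ b) y z)).card ≤ κ := by
          have hs : (Bc c).filter (fun b => ∃ z ∈ Z0, ∃ y ∈ W b c, G (ξ b) y z) ⊆
              Z0.biUnion (fun z => (Bc c).filter (fun b => ∃ y ∈ W b c, G (ξ b) y z)) := by
            intro b hb
            simp only [mem_filter, mem_biUnion] at hb ⊢
            obtain ⟨hb, z, hz, y, hy⟩ := hb
            exact ⟨z, hz, hb, y, hy⟩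
          calc _ ≤ _ := card_le_card hs
            _ ≤ _ := card_biUnion_le
            _ ≤ ∑ _z ∈ Z0, r := by
              apply sum_le_sum
              intro z hz
              rw [← hξ] at hz
              exact (mem_filter.1 hz).2.le
            _ = Z0.card * r := by simp
            _ ≤ m * r := Nat.mul_le_mul_right _ (hm ▸ card_le_univ _)
            _ ≤ κ := by rw [mul_comm]; exact hrm
        have hsplit := card_filter_add_card_filter_not (s := Bc c)
          (fun b => ∃ z ∈ Z0, ∃ y ∈ W b c, G (ξ b) y z)
        have hle : κ ≤ ((Bc c).filter (fun b => ¬ ∃ z ∈ Z0, ∃ y ∈ W b c, G (ξ b) y z)).card := by omega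
        obtain ⟨B', hB', hB'c⟩ := exists_subset_card_eq hle
        refine ⟨B', hB'c, fun b hb => ?_⟩
        have hb := hB' hb
        simp only [mem_filter] at hb
        obtain ⟨hb1, hb2⟩ := hb
        have hb1 : s ≤ (W b c).card := by simpa [hBc] using hb1
        constructor
        · rw [hm, hqs]
          apply Nat.mul_le_mul_right
          by_contra hlt
          push Not at hlt
          obtain ⟨x, hx, y, hy, z, hz, hxyz⟩ := hG _ _ _ hlt.le hb1 hZ
          exact (mem_filter.1 hx).2 y hy z hz hxyz
        · simp only [mem_filter, mem_univ, true_and]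
          intro y hy z hz hg
          exact hb2 ⟨z, hz, y, hy, hg⟩
    calc _ ≤ (∑ Z0 ∈ Fam, (univ.filter (fun ξ : Fin k → V => s ≤ Z0.card ∧ few ξ c = Z0)).card) * q ^ κ :=
          Nat.mul_le_mul_right _ ((card_le_card hsub).trans card_biUnion_le)
      _ = _ := sum_mul _ _ _
      _ ≤ ∑ _Z0 ∈ Fam, (2 ^ k * m ^ k) := sum_le_sum hone
      _ = Fam.card * (2 ^ k * m ^ k) := by simp
      _ ≤ _ := by
        apply Nat.mul_le_mul_right
        calc Fam.card ≤ (univ : Finset (Finset V)).card := card_le_card (filter_subset _ _)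
          _ = 2 ^ m := by simp [hm]
  have claim2 : ∀ ξ : Fin k → V, (univ.filter (fun ζ : Fin k → V =>
      (∀ c ∈ C', (few ξ c).card < s) ∧ kills G W ξ ζ < κ * r)).card * q ^ κ ≤ 2 ^ k * m ^ k := by
    intro ξ
    have := count_small (I := Fin k) (V := V) q κ (fun c => few ξ c)
      (fun ζ : Fin k → V => (∀ c ∈ C', (few ξ c).card < s) ∧ kills G W ξ ζ < κ * r) ?_
    · simpa [hm] using this
    · rintro ζ ⟨hsm, hkill⟩
      have hle : κ ≤ (C'.filter (fun c => ζ c ∈ few ξ c)).card := by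
        by_contra hlt
        push Not at hlt
        have hsplit := card_filter_add_card_filter_not (s := C') (fun c => ζ c ∈ few ξ c)
        have hge : κ ≤ (C'.filter (fun c => ¬ ζ c ∈ few ξ c)).card := by omega
        have : κ * r ≤ kills G W ξ ζ := by
          unfold kills
          rw [sum_comm]
          calc κ * r ≤ (C'.filter (fun c => ¬ ζ c ∈ few ξ c)).card * r := Nat.mul_le_mul_right _ hge
            _ = ∑ c ∈ C'.filter (fun c => ¬ ζ c ∈ few ξ c), r := by simp
            _ ≤ ∑ c ∈ C'.filter (fun c => ¬ ζ c ∈ few ξ c),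
                ∑ b, ((W b c).filter (fun y => G (ξ b) y (ζ c))).card := by
              apply sum_le_sum
              intro c hc
              have hc := (mem_filter.1 hc).2
              simp only [hfew, mem_filter, mem_univ, true_and, not_lt] at hc
              refine hc.trans ?_
              rw [card_eq_sum_ones]
              calc _ ≤ ∑ b ∈ (Bc c).filter (fun b => ∃ y ∈ W b c, G (ξ b) y (ζ c)),
                    ((W b c).filter (fun y => G (ξ b) y (ζ c))).card := by
                    apply sum_le_sum
                    intro b hb
                    obtain ⟨y, hy, hg⟩ := (mem_filter.1 hb).2
                    exact card_pos.2 ⟨y, mem_filter.2 ⟨hy, hg⟩⟩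
                _ ≤ _ := sum_le_sum_of_subset (subset_univ _)
            _ ≤ _ := sum_le_sum_of_subset (subset_univ _)
        omega
      obtain ⟨C2, hC2, hC2c⟩ := exists_subset_card_eq hle
      refine ⟨C2, hC2c, fun c hc => ?_⟩
      have hc := mem_filter.1 (hC2 hc)
      refine ⟨?_, hc.2⟩
      rw [hm, hqs]
      exact Nat.mul_le_mul_right _ (hsm c hc.1).le
  have hXi : (univ.filter (fun ξ : Fin k → V => ∃ c ∈ C', s ≤ (few ξ c).card)).card * q ^ κ ≤
      k * (2 ^ m * (2 ^ k * m ^ k)) := by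
    have hsub : univ.filter (fun ξ : Fin k → V => ∃ c ∈ C', s ≤ (few ξ c).card) ⊆
        C'.biUnion (fun c => univ.filter (fun ξ : Fin k → V => s ≤ (few ξ c).card)) := by
      intro ξ hξ
      simpa using hξ
    calc _ ≤ (∑ c ∈ C', (univ.filter (fun ξ : Fin k → V => s ≤ (few ξ c).card)).card) * q ^ κ :=
          Nat.mul_le_mul_right _ ((card_le_card hsub).trans card_biUnion_le)
      _ = _ := sum_mul _ _ _
      _ ≤ ∑ _c ∈ C', (2 ^ m * (2 ^ k * m ^ k)) := sum_le_sum claim1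
      _ = C'.card * (2 ^ m * (2 ^ k * m ^ k)) := by simp
      _ ≤ _ := Nat.mul_le_mul_right _ ((card_le_univ _).trans (by simp))
  have hsub : univ.filter (fun p : (Fin k → V) × (Fin k → V) => kills G W p.1 p.2 < κ * r) ⊆
      (univ.filter (fun p : (Fin k → V) × (Fin k → V) => ∃ c ∈ C', s ≤ (few p.1 c).card)) ∪
      (univ.filter (fun p : (Fin k → V) × (Fin k → V) =>
        (∀ c ∈ C', (few p.1 c).card < s) ∧ kills G W p.1 p.2 < κ * r)) := by
    intro p hp
    have hp := (mem_filter.1 hp).2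
    rw [mem_union]
    by_cases h : ∃ c ∈ C', s ≤ (few p.1 c).card
    · left; exact mem_filter.2 ⟨mem_univ _, h⟩
    · right
      push Not at h
      exact mem_filter.2 ⟨mem_univ _, h, hp⟩
  have hA := count_fst_only (X := Fin k → V) (Y := Fin k → V) (fun ξ => ∃ c ∈ C', s ≤ (few ξ c).card)
  have hB := count_fst (X := Fin k → V) (Y := Fin k → V) (fun ξ ζ =>
        (∀ c ∈ C', (few ξ c).card < s) ∧ kills G W ξ ζ < κ * r) (q ^ κ) _ claim2
  have hcard : Fintype.card (Fin k → V) = m ^ k := by simp [hm]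
  rw [hcard] at hA hB
  have hk2 : k + 1 ≤ 2 ^ k := Nat.lt_two_pow_self
  have h2m : 2 ^ m ≤ 2 ^ k := Nat.pow_le_pow_right (by norm_num) hmk
  calc _ ≤ _ := Nat.mul_le_mul_right _ ((card_le_card hsub).trans (card_union_le _ _))
    _ = _ := add_mul _ _ _
    _ ≤ k * (2 ^ m * (2 ^ k * m ^ k)) * m ^ k + m ^ k * (2 ^ k * m ^ k) := by
      apply add_le_add _ hB
      rw [hA, mul_right_comm]
      exact Nat.mul_le_mul_right _ hXi
    _ = (k * 2 ^ m + 1) * (2 ^ k * m ^ (2 * k)) := by ring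
    _ ≤ (2 ^ k * 2 ^ k) * (2 ^ k * m ^ (2 * k)) := by
      apply Nat.mul_le_mul_right
      nlinarith
    _ = _ := by
      have : (8 : ℕ) = 2 * 2 * 2 := by norm_num
      rw [this, mul_pow, mul_pow]; ring

/-- Values still allowed after seeing the vectors indexed by `S`. -/
noncomputable def allowed (G : V → V → V → Prop) {k : ℕ} (S : Finset (Fin k))
    (w : Fin k → (Fin k → V) × (Fin k → V)) : Fin k → Fin k → Finset V :=
  fun b c => univ.filter (fun y => ∀ a ∈ S, ¬ G ((w a).1 b) y ((w a).2 c))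

lemma greedy (G : V → V → V → Prop) (k κ m r : ℕ) (hk : k = 8 * κ)
    (hm : Fintype.card V = m) (hm0 : 0 < m) (hκ : 0 < κ) (hr : r = 16 * m)
    (w : Fin k → (Fin k → V) × (Fin k → V)) :
    ∃ S : Finset (Fin k), S.card ≤ 4 * κ ∧
      ∀ a, a ∉ S → kills G (allowed G S w) (w a).1 (w a).2 < κ * r := by
  set Φ : Finset (Fin k) → ℕ := fun S => ∑ b, ∑ c, (allowed G S w b c).card with hΦ
  set Fam : Finset (Finset (Fin k)) := univ.filter (fun S => S.card * (κ * r) + Φ S ≤ k ^ 2 * m)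
  have hne : Fam.Nonempty := by
    refine ⟨∅, ?_⟩
    simp only [Fam, mem_filter, mem_univ, true_and, card_empty, zero_mul, zero_add, hΦ]
    calc _ ≤ ∑ _b : Fin k, ∑ _c : Fin k, m := by
          apply sum_le_sum; intro b _; apply sum_le_sum; intro c _
          exact hm ▸ card_le_univ _
      _ = _ := by simp; ring
  obtain ⟨S, hS, hmax⟩ := exists_max_image Fam card hne
  have hS : S.card * (κ * r) + Φ S ≤ k ^ 2 * m := by simpa [Fam] using hS
  refine ⟨S, ?_, ?_⟩
  · have : S.card * (κ * r) ≤ (4 * κ) * (κ * r) := by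
      calc _ ≤ k ^ 2 * m := by omega
        _ = _ := by rw [hk, hr]; ring
    exact Nat.le_of_mul_le_mul_right this (by rw [hr]; positivity)
  · intro a ha
    by_contra hlt
    push Not at hlt
    have hΦ' : Φ (insert a S) + kills G (allowed G S w) (w a).1 (w a).2 = Φ S := by
      simp only [hΦ, kills, ← sum_add_distrib]
      apply sum_congr rfl; intro b _; apply sum_congr rfl; intro c _
      have := card_filter_add_card_filter_not (s := allowed G S w b c)
        (fun y => G ((w a).1 b) y ((w a).2 c))
      rw [← this, add_comm]
      congr 2
      ext y
      simp only [allowed, mem_filter, mem_univ, true_and, mem_insert, forall_eq_or_imp]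
      tauto
    have hmem : insert a S ∈ Fam := by
      simp only [Fam, mem_filter, mem_univ, true_and]
      rw [card_insert_of_notMem ha, add_mul]
      omega
    have := hmax _ hmem
    rw [card_insert_of_notMem ha] at this
    omega

lemma blue_count (G : V → V → V → Prop) (k κ m q s : ℕ) (hk : k = 8 * κ)
    (hm : Fintype.card V = m) (hm0 : 0 < m) (hqs : m = s * q) (hκm : κ = 16 * m ^ 2)
    (hG : BoxDense G s) :
    (univ.filter (fun p : (Fin k → (Fin k → V) × (Fin k → V)) × (Fin k × Fin k → V) =>
      ∀ a b c, ¬ G ((p.1 a).1 b) (p.2 (b, c)) ((p.1 a).2 c))).card * q ^ (4 * κ ^ 2)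
      ≤ 32 ^ (k ^ 2) * m ^ (3 * k ^ 2) := by
  have hq0 : 0 < q := by
    rcases Nat.eq_zero_or_pos q with h | h
    · subst h; omega
    · exact h
  have hκ0 : 0 < κ := by rw [hκm]; positivity
  have hrm : (16 * m) * m ≤ κ := by rw [hκm]; apply le_of_eq; ring
  have hmk : m ≤ k := by rw [hk, hκm]; nlinarith
  have hΩ : Fintype.card ((Fin k → V) × (Fin k → V)) = m ^ (2 * k) := by
    simp [hm]; ring
  set poor : Finset (Fin k) → Finset ((Fin k → (Fin k → V) × (Fin k → V)) × (Fin k × Fin k → V)) :=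
    fun S => univ.filter (fun p => ¬ Rich (allowed G S p.1) s ∧
      ∀ b c, p.2 (b, c) ∈ allowed G S p.1 b c) with hpoor
  set rich : Finset (Fin k) → Finset ((Fin k → (Fin k → V) × (Fin k → V)) × (Fin k × Fin k → V)) :=
    fun S => univ.filter (fun p => Rich (allowed G S p.1) s ∧
      ∀ a, a ∉ S → kills G (allowed G S p.1) (p.1 a).1 (p.1 a).2 < κ * (16 * m)) with hrich
  have hpoorc : ∀ S, (poor S).card * q ^ (4 * κ ^ 2) ≤ m ^ (2 * k ^ 2) * (2 ^ (k ^ 2) * m ^ (k ^ 2)) := by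
    intro S
    have h := count_fst (X := Fin k → (Fin k → V) × (Fin k → V)) (Y := Fin k × Fin k → V)
      (fun w Y => ¬ Rich (allowed G S w) s ∧ ∀ b c, Y (b, c) ∈ allowed G S w b c)
      (q ^ (4 * κ ^ 2)) (2 ^ (k ^ 2) * m ^ (k ^ 2)) ?_
    · refine h.trans (le_of_eq ?_)
      congr 1
      rw [Fintype.card_fun, hΩ, Fintype.card_fin, ← pow_mul]
      ring_nf
    · intro w
      have := count_small (I := Fin k × Fin k) (V := V) q (4 * κ ^ 2)
        (fun p => allowed G S w p.1 p.2)
        (fun Y => ¬ Rich (allowed G S w) s ∧ ∀ b c, Y (b, c) ∈ allowed G S w b c) ?_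
      · simpa [hm, ← sq] using this
      · rintro Y ⟨hR, hY⟩
        unfold Rich at hR
        have hsplit := card_filter_add_card_filter_not (s := (univ : Finset (Fin k × Fin k)))
          (fun p => s ≤ (allowed G S w p.1 p.2).card)
        have hu : (univ : Finset (Fin k × Fin k)).card = k ^ 2 := by simp [sq]
        have hle : 4 * κ ^ 2 ≤ ((univ : Finset (Fin k × Fin k)).filter
            (fun p => ¬ s ≤ (allowed G S w p.1 p.2).card)).card := by
          have : k ^ 2 = 64 * κ ^ 2 := by rw [hk]; ring
          omega
        obtain ⟨B', hB', hB'c⟩ := exists_subset_card_eq hle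
        refine ⟨B', hB'c, fun p hp => ⟨?_, hY p.1 p.2⟩⟩
        have := (mem_filter.1 (hB' hp)).2
        rw [hm, hqs]
        exact Nat.mul_le_mul_right _ (by omega)
  have hrichc : ∀ S : Finset (Fin k), S.card ≤ 4 * κ →
      (rich S).card * q ^ (4 * κ ^ 2) ≤ 8 ^ (k ^ 2) * m ^ (2 * k ^ 2) * m ^ (k ^ 2) := by
    intro S hS
    have h1 := count_fst_only (X := Fin k → (Fin k → V) × (Fin k → V)) (Y := Fin k × Fin k → V)
      (fun w => Rich (allowed G S w) s ∧
      ∀ a, a ∉ S → kills G (allowed G S w) (w a).1 (w a).2 < κ * (16 * m))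
    have h2 := count_dep (A := Fin k) S
      (fun w => univ.filter (fun p : (Fin k → V) × (Fin k → V) =>
        kills G (allowed G S w) p.1 p.2 < κ * (16 * m))) ?_ (8 ^ k * m ^ (2 * k) / q ^ κ)
      (fun w => Rich (allowed G S w) s ∧
        ∀ a, a ∉ S → kills G (allowed G S w) (w a).1 (w a).2 < κ * (16 * m)) ?_
    · have hrc : (rich S).card = _ := h1
      rw [hrc, Fintype.card_fun, hm, Fintype.card_prod, Fintype.card_fin, ← sq, mul_right_comm]
      apply Nat.mul_le_mul_right
      rw [hΩ, Fintype.card_fin] at h2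
      have hexp : q ^ (4 * κ ^ 2) ≤ (q ^ κ) ^ (k - S.card) := by
        rw [← pow_mul]
        apply Nat.pow_le_pow_right hq0
        calc 4 * κ ^ 2 = κ * (4 * κ) := by ring
          _ ≤ κ * (k - S.card) := Nat.mul_le_mul_left _ (by omega)
      have hSk : S.card ≤ k := by omega
      calc _ ≤ ((m ^ (2 * k)) ^ S.card * (8 ^ k * m ^ (2 * k) / q ^ κ) ^ (k - S.card)) *
            (q ^ κ) ^ (k - S.card) := Nat.mul_le_mul h2 hexp
        _ = (m ^ (2 * k)) ^ S.card * ((8 ^ k * m ^ (2 * k) / q ^ κ) * q ^ κ) ^ (k - S.card) := by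
            rw [mul_pow]; ring
        _ ≤ (m ^ (2 * k)) ^ S.card * (8 ^ k * m ^ (2 * k)) ^ (k - S.card) := by
            apply Nat.mul_le_mul_left
            exact Nat.pow_le_pow_left (Nat.div_mul_le_self _ _) _
        _ = (8 ^ k) ^ (k - S.card) * ((m ^ (2 * k)) ^ S.card * (m ^ (2 * k)) ^ (k - S.card)) := by
            rw [mul_pow]; ring
        _ = (8 ^ k) ^ (k - S.card) * (m ^ (2 * k)) ^ k := by
            rw [← pow_add, Nat.add_sub_cancel' hSk]
        _ ≤ (8 ^ k) ^ k * (m ^ (2 * k)) ^ k := by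
            gcongr
            · exact Nat.one_le_pow _ _ (by norm_num)
            · omega
        _ = _ := by rw [← pow_mul, ← pow_mul]; ring_nf
    · intro w w' hww
      have : allowed G S w = allowed G S w' := by
        funext b c
        simp only [allowed]
        apply filter_congr
        intro y _
        constructor
        · intro h a ha; rw [← hww a ha]; exact h a ha
        · intro h a ha; rw [hww a ha]; exact h a ha
      simp only [this]
    · rintro w ⟨hR, hw⟩
      constructor
      · rw [Nat.le_div_iff_mul_le (by positivity)]
        exact rich_bad G k κ m q s (16 * m) hk hm hqs hrm hmk hG _ hR
      · intro a ha
        simpa using hw a ha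
  have hsub : univ.filter (fun p : (Fin k → (Fin k → V) × (Fin k → V)) × (Fin k × Fin k → V) =>
      ∀ a b c, ¬ G ((p.1 a).1 b) (p.2 (b, c)) ((p.1 a).2 c)) ⊆
      (univ.filter (fun S : Finset (Fin k) => S.card ≤ 4 * κ)).biUnion (fun S => poor S ∪ rich S) := by
    intro p hp
    have hp := (mem_filter.1 hp).2
    obtain ⟨S, hS, hS2⟩ := greedy G k κ m (16 * m) hk hm hm0 hκ0 rfl p.1
    rw [mem_biUnion]
    refine ⟨S, by simp [hS], ?_⟩
    rw [mem_union]
    by_cases hR : Rich (allowed G S p.1) s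
    · right
      exact mem_filter.2 ⟨mem_univ _, hR, hS2⟩
    · left
      refine mem_filter.2 ⟨mem_univ _, hR, fun b c => ?_⟩
      simp only [allowed, mem_filter, mem_univ, true_and]
      exact fun a _ => hp a b c
  have hk1 : 1 ≤ k := by omega
  have hone : ∀ S ∈ univ.filter (fun S : Finset (Fin k) => S.card ≤ 4 * κ),
      (poor S ∪ rich S).card * q ^ (4 * κ ^ 2) ≤ 2 * 8 ^ (k ^ 2) * m ^ (3 * k ^ 2) := by
    intro S hS
    calc _ ≤ _ := Nat.mul_le_mul_right _ (card_union_le _ _)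
      _ = _ := add_mul _ _ _
      _ ≤ _ := add_le_add (hpoorc S) (hrichc S (mem_filter.1 hS).2)
      _ = (2 ^ (k ^ 2) + 8 ^ (k ^ 2)) * (m ^ (2 * k ^ 2) * m ^ (k ^ 2)) := by ring
      _ ≤ (2 * 8 ^ (k ^ 2)) * (m ^ (2 * k ^ 2) * m ^ (k ^ 2)) := by
        apply Nat.mul_le_mul_right
        have : 2 ^ (k ^ 2) ≤ 8 ^ (k ^ 2) := Nat.pow_le_pow_left (by norm_num) _
        omega
      _ = _ := by rw [← pow_add]; ring_nf
  calc _ ≤ _ := Nat.mul_le_mul_right _ ((card_le_card hsub).trans card_biUnion_le)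
    _ = _ := sum_mul _ _ _
    _ ≤ _ := sum_le_sum hone
    _ = (univ.filter (fun S : Finset (Fin k) => S.card ≤ 4 * κ)).card * (2 * 8 ^ (k ^ 2) * m ^ (3 * k ^ 2)) := by simp
    _ ≤ 2 ^ k * (2 * 8 ^ (k ^ 2) * m ^ (3 * k ^ 2)) := by
      apply Nat.mul_le_mul_right
      calc _ ≤ (univ : Finset (Finset (Fin k))).card := card_le_card (filter_subset _ _)
        _ = _ := by simp
    _ = (2 ^ (k + 1) * 8 ^ (k ^ 2)) * m ^ (3 * k ^ 2) := by ring
    _ ≤ (2 ^ (2 * k ^ 2) * 8 ^ (k ^ 2)) * m ^ (3 * k ^ 2) := by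
      gcongr
      · norm_num
      · nlinarith
    _ = _ := by
      rw [pow_mul, ← mul_pow]
      norm_num

end Core

/-! ### A sparse, locally tree-like, box-dense oriented 3-graph -/

section Sparse
open Finset Classical

/-- The set of coordinates of a triple. -/
def coords {m : ℕ} (p : Fin m × Fin m × Fin m) : Finset (Fin m) := {p.1, p.2.1, p.2.2}

lemma bad_one (m M h : ℕ) (hmh : 2 * h ≤ m) (T : Finset (Fin M)) (hT : T.card ≤ h) (hT1 : T.Nonempty) :
    (univ.filter (fun τ : Fin M → Fin m × Fin m × Fin m =>
      (T.biUnion (fun i => coords (τ i))).card ≤ 2 * T.card)).card * m ^ T.card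
      ≤ (8 * h ^ 3) ^ h * (m ^ 3) ^ M := by
  set t := T.card with ht
  have ht1 : 1 ≤ t := card_pos.2 hT1
  have htM : t ≤ M := by simpa using card_le_univ T
  have hsub : (univ.filter (fun τ : Fin M → Fin m × Fin m × Fin m =>
      (T.biUnion (fun i => coords (τ i))).card ≤ 2 * t)) ⊆
      ((univ : Finset (Fin m)).powersetCard (2 * t)).biUnion (fun U =>
        Fintype.piFinset (fun i => if i ∈ T then U ×ˢ (U ×ˢ U) else univ)) := by
    intro τ hτ
    have hτ := (mem_filter.1 hτ).2
    obtain ⟨U, hU1, hU2⟩ := exists_superset_card_eq hτ (by simp; omega)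
    rw [mem_biUnion]
    refine ⟨U, by simp [mem_powersetCard, hU2], ?_⟩
    rw [Fintype.mem_piFinset]
    intro i
    split_ifs with hi
    · have : coords (τ i) ⊆ U := (subset_biUnion_of_mem (fun i => coords (τ i)) hi).trans hU1
      simp only [mem_product]
      exact ⟨this (by simp [coords]), this (by simp [coords]), this (by simp [coords])⟩
    · simp
  have hone : ∀ U ∈ (univ : Finset (Fin m)).powersetCard (2 * t),
      (Fintype.piFinset (fun i : Fin M => if i ∈ T then U ×ˢ (U ×ˢ U) else univ)).card ≤
        (8 * h ^ 3) ^ h * (m ^ 3) ^ (M - t) := by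
    intro U hU
    have hU := (mem_powersetCard.1 hU).2
    rw [Fintype.card_piFinset]
    have : ∀ i : Fin M, (if i ∈ T then U ×ˢ (U ×ˢ U) else univ).card =
        if i ∈ T then (8 * t ^ 3) else m ^ 3 := by
      intro i
      split_ifs
      · rw [card_product, card_product, hU]; ring
      · simp; ring
    simp_rw [this]
    rw [prod_ite, prod_const, prod_const, filter_not, ← compl_eq_univ_sdiff, card_compl,
      filter_mem_eq_inter, univ_inter, Fintype.card_fin, ← ht]
    apply Nat.mul_le_mul_right
    calc (8 * t ^ 3) ^ t ≤ (8 * h ^ 3) ^ t := by gcongr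
      _ ≤ _ := Nat.pow_le_pow_right (by have : 1 ≤ h := by omega
                                        positivity) hT
  have hmul : m ^ (2 * t) * (m ^ 3) ^ (M - t) * m ^ t = (m ^ 3) ^ M := by
    calc _ = (m ^ 3) ^ t * (m ^ 3) ^ (M - t) := by
          rw [← pow_mul m 3 t]
          calc _ = (m ^ (2 * t) * m ^ t) * (m ^ 3) ^ (M - t) := by ring
            _ = _ := by rw [← pow_add]; congr 2; ring
      _ = _ := by rw [← pow_add, Nat.add_sub_cancel' htM]
  calc _ ≤ (∑ U ∈ (univ : Finset (Fin m)).powersetCard (2 * t),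
        (Fintype.piFinset (fun i : Fin M => if i ∈ T then U ×ˢ (U ×ˢ U) else univ)).card) * m ^ t :=
        Nat.mul_le_mul_right _ ((card_le_card hsub).trans card_biUnion_le)
    _ ≤ (∑ U ∈ (univ : Finset (Fin m)).powersetCard (2 * t), ((8 * h ^ 3) ^ h * (m ^ 3) ^ (M - t))) * m ^ t :=
        Nat.mul_le_mul_right _ (sum_le_sum hone)
    _ = (m.choose (2 * t)) * ((8 * h ^ 3) ^ h * (m ^ 3) ^ (M - t)) * m ^ t := by simp [card_powersetCard]
    _ ≤ m ^ (2 * t) * ((8 * h ^ 3) ^ h * (m ^ 3) ^ (M - t)) * m ^ t := by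
        gcongr
        exact Nat.choose_le_pow _ _
    _ = (8 * h ^ 3) ^ h * (m ^ (2 * t) * (m ^ 3) ^ (M - t) * m ^ t) := by ring
    _ = _ := by rw [hmul]

/-- Index sets of at most `h` triples that span too few vertices. -/
noncomputable def badSets {m M : ℕ} (h : ℕ) (τ : Fin M → Fin m × Fin m × Fin m) :
    Finset (Finset (Fin M)) :=
  univ.filter (fun T => (T.Nonempty ∧ T.card ≤ h) ∧ (T.biUnion (fun i => coords (τ i))).card ≤ 2 * T.card)

lemma sum_bad (m M h q : ℕ) (hmh : 2 * h ≤ m) (hm0 : 0 < m) (hq : 0 < q) (hm : m = q ^ (4 * h))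
    (hM : M = m * q ^ 4) :
    ∑ τ : Fin M → Fin m × Fin m × Fin m, (badSets h τ).card ≤
      h * (m * ((8 * h ^ 3) ^ h * (m ^ 3) ^ M)) := by
  set K := (8 * h ^ 3) ^ h * (m ^ 3) ^ M with hK
  have h1 : ∑ τ : Fin M → Fin m × Fin m × Fin m, (badSets h τ).card =
      ∑ T : Finset (Fin M), if T.Nonempty ∧ T.card ≤ h then
        (univ.filter (fun τ : Fin M → Fin m × Fin m × Fin m =>
          (T.biUnion (fun i => coords (τ i))).card ≤ 2 * T.card)).card else 0 := by
    simp only [badSets, card_filter]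
    rw [sum_comm]
    refine sum_congr rfl fun T _ => ?_
    split_ifs with hc
    · simp only [hc.1, hc.2, true_and]
    · apply sum_eq_zero
      intro τ _
      rw [if_neg]
      tauto
  have h2 : ∀ t ∈ Icc 1 h, ∑ T ∈ (univ : Finset (Fin M)).powersetCard t,
      (univ.filter (fun τ : Fin M → Fin m × Fin m × Fin m =>
          (T.biUnion (fun i => coords (τ i))).card ≤ 2 * T.card)).card ≤ m * K := by
    intro t ht
    rw [mem_Icc] at ht
    have : (∑ T ∈ (univ : Finset (Fin M)).powersetCard t,
      (univ.filter (fun τ : Fin M → Fin m × Fin m × Fin m =>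
          (T.biUnion (fun i => coords (τ i))).card ≤ 2 * T.card)).card) * m ^ t ≤ (m * K) * m ^ t := by
      rw [sum_mul]
      calc _ ≤ ∑ T ∈ (univ : Finset (Fin M)).powersetCard t, K := by
            apply sum_le_sum
            intro T hT
            have hT := (mem_powersetCard.1 hT).2
            have := bad_one m M h hmh T (by omega) (card_pos.1 (by omega))
            rw [← hT]
            exact this
        _ = M.choose t * K := by simp [card_powersetCard]
        _ ≤ M ^ t * K := Nat.mul_le_mul_right _ (Nat.choose_le_pow _ _)
        _ = (q ^ (4 * t) * K) * m ^ t := by rw [hM, mul_pow, ← pow_mul]; ring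
        _ ≤ _ := by
          apply Nat.mul_le_mul_right
          apply Nat.mul_le_mul_right
          rw [hm]
          exact Nat.pow_le_pow_right hq (by omega)
    exact Nat.le_of_mul_le_mul_right this (by positivity)
  rw [h1, ← sum_filter]
  have hsub : univ.filter (fun T : Finset (Fin M) => T.Nonempty ∧ T.card ≤ h) ⊆
      (Icc 1 h).biUnion (fun t => (univ : Finset (Fin M)).powersetCard t) := by
    intro T hT
    have hT := (mem_filter.1 hT).2
    rw [mem_biUnion]
    exact ⟨T.card, mem_Icc.2 ⟨card_pos.2 hT.1, hT.2⟩, by simp [mem_powersetCard]⟩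
  calc _ ≤ _ := sum_le_sum_of_subset hsub
    _ ≤ ∑ t ∈ Icc 1 h, ∑ T ∈ (univ : Finset (Fin M)).powersetCard t,
      (univ.filter (fun τ : Fin M → Fin m × Fin m × Fin m =>
          (T.biUnion (fun i => coords (τ i))).card ≤ 2 * T.card)).card := by
        rw [sum_biUnion]
        intro a _ b _ hab
        exact pairwise_disjoint_powersetCard _ hab
    _ ≤ ∑ t ∈ Icc 1 h, m * K := sum_le_sum h2
    _ = _ := by simp

lemma few_hits (m M R s : ℕ) (Bx : Finset (Fin m × Fin m × Fin m)) (hB : s ^ 3 ≤ Bx.card) :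
    (univ.filter (fun τ : Fin M → Fin m × Fin m × Fin m =>
      (univ.filter (fun i => τ i ∈ Bx)).card ≤ R)).card * 2 ^ M ≤ 2 ^ R * (2 * m ^ 3 - s ^ 3) ^ M := by
  have h1 : ∑ v : Fin m × Fin m × Fin m, (if v ∈ Bx then 1 else 2) ≤ 2 * m ^ 3 - s ^ 3 := by
    have : ∑ v : Fin m × Fin m × Fin m, (if v ∈ Bx then 1 else 2) + Bx.card = 2 * m ^ 3 := by
      have e : Bx.card = ∑ v : Fin m × Fin m × Fin m, (if v ∈ Bx then 1 else 0) := by simp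
      rw [e, ← sum_add_distrib]
      have : ∀ v : Fin m × Fin m × Fin m, ((if v ∈ Bx then 1 else 2) + if v ∈ Bx then 1 else 0) = 2 := by
        intro v; split_ifs <;> rfl
      simp_rw [this]
      simp; ring
    omega
  have h2 : ∀ τ : Fin M → Fin m × Fin m × Fin m, 2 ^ M =
      2 ^ (univ.filter (fun i => τ i ∈ Bx)).card * ∏ i, (if τ i ∈ Bx then 1 else 2) := by
    intro τ
    have : 2 ^ (univ.filter (fun i => τ i ∈ Bx)).card = ∏ i : Fin M, (if τ i ∈ Bx then 2 else 1) := by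
      rw [prod_ite]; simp
    rw [this, ← prod_mul_distrib]
    have : ∀ i, ((if τ i ∈ Bx then 2 else 1) * if τ i ∈ Bx then 1 else 2) = 2 := by
      intro i; split_ifs <;> rfl
    simp_rw [this]
    simp
  calc _ = ∑ τ ∈ univ.filter (fun τ : Fin M → Fin m × Fin m × Fin m =>
      (univ.filter (fun i => τ i ∈ Bx)).card ≤ R), 2 ^ M := by simp
    _ ≤ ∑ τ ∈ univ.filter (fun τ : Fin M → Fin m × Fin m × Fin m =>
      (univ.filter (fun i => τ i ∈ Bx)).card ≤ R), 2 ^ R * ∏ i, (if τ i ∈ Bx then 1 else 2) := by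
        apply sum_le_sum
        intro τ hτ
        rw [h2 τ]
        apply Nat.mul_le_mul_right
        exact Nat.pow_le_pow_right (by norm_num) (mem_filter.1 hτ).2
    _ ≤ ∑ τ : Fin M → Fin m × Fin m × Fin m, 2 ^ R * ∏ i, (if τ i ∈ Bx then 1 else 2) :=
        sum_le_sum_of_subset (subset_univ _)
    _ = 2 ^ R * (∑ v : Fin m × Fin m × Fin m, (if v ∈ Bx then 1 else 2)) ^ M := by
        rw [← mul_sum, Fintype.sum_pow]
    _ ≤ _ := by gcongr

lemma numeric_box (K m q s M : ℕ) (hm0 : 0 < m) (hqs : m = s * q) (hM : M = m * q ^ 4)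
    (hq : 2 * (K + 5) ≤ q) :
    2 * (8 ^ m * (2 ^ (K * m) * (2 * m ^ 3 - s ^ 3) ^ M)) < 2 ^ M * (m ^ 3) ^ M := by
  have hs0 : 0 < s := by
    rcases Nat.eq_zero_or_pos s with h | h
    · subst h; omega
    · exact h
  have hq0 : 0 < q := by omega
  have hsm : s ≤ m := by rw [hqs]; exact Nat.le_mul_of_pos_right _ hq0
  have hs3 : s ^ 3 ≤ 2 * m ^ 3 := by
    have := Nat.pow_le_pow_left hsm 3
    omega
  rw [← @Nat.cast_lt ℝ]
  push_cast [Nat.cast_sub hs3]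
  have hmr : (m : ℝ) = s * q := by rw [hqs]; push_cast; ring
  have hqr : (0 : ℝ) < q := by exact_mod_cast hq0
  have hsr : (0 : ℝ) < s := by exact_mod_cast hs0
  have hmr0 : (0 : ℝ) < m := by exact_mod_cast hm0
  have e1 : (2 * (m : ℝ) ^ 3 - s ^ 3) = 2 * m ^ 3 * (1 - 1 / (2 * q ^ 3)) := by
    rw [hmr]; field_simp
  have e2 : (1 - 1 / (2 * (q : ℝ) ^ 3)) ^ M ≤ Real.exp (- (m * q / 2)) := by
    have a1 : (1 - 1 / (2 * (q : ℝ) ^ 3)) ≤ Real.exp (- (1 / (2 * (q : ℝ) ^ 3))) := by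
      have := Real.add_one_le_exp (- (1 / (2 * (q : ℝ) ^ 3)))
      linarith
    have a0 : 0 ≤ (1 - 1 / (2 * (q : ℝ) ^ 3)) := by
      have : (1 : ℝ) ≤ q ^ 3 := one_le_pow₀ (by exact_mod_cast hq0)
      rw [sub_nonneg, div_le_one (by positivity)]
      linarith
    calc _ ≤ (Real.exp (- (1 / (2 * (q : ℝ) ^ 3)))) ^ M := pow_le_pow_left₀ a0 a1 _
      _ = Real.exp (M * (- (1 / (2 * (q : ℝ) ^ 3)))) := by rw [← Real.exp_nat_mul]
      _ = _ := by
        congr 1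
        rw [hM]; push_cast; field_simp
  have e3 : (2 : ℝ) * (8 ^ m * 2 ^ (K * m)) * Real.exp (- (m * q / 2)) < 1 := by
    rw [Real.exp_neg, ← div_eq_mul_inv, div_lt_one (Real.exp_pos _)]
    have b1 : ((2 : ℝ) ^ (K + 5)) ^ m < (Real.exp 1 ^ (K + 5)) ^ m := by
      apply pow_lt_pow_left₀ _ (by positivity) (by omega)
      exact pow_lt_pow_left₀ (by linarith [Real.exp_one_gt_d9]) (by norm_num) (by omega)
    have b2 : (Real.exp 1 ^ (K + 5)) ^ m ≤ Real.exp (m * q / 2) := by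
      rw [← Real.exp_nat_mul, ← Real.exp_nat_mul]
      apply Real.exp_le_exp.2
      have : (2 * ((K : ℝ) + 5)) ≤ q := by exact_mod_cast hq
      push_cast
      have := mul_le_mul_of_nonneg_left this hmr0.le
      linarith
    have b3 : (2 : ℝ) * (8 ^ m * 2 ^ (K * m)) ≤ ((2 : ℝ) ^ (K + 5)) ^ m := by
      have c1 : ((2 : ℝ) ^ (K + 5)) ^ m = 2 ^ m * 2 ^ m * (8 ^ m * 2 ^ (K * m)) := by
        calc ((2 : ℝ) ^ (K + 5)) ^ m = (2 * 2 * (8 * 2 ^ K)) ^ m := by congr 1; ring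
          _ = _ := by rw [mul_pow, mul_pow, mul_pow, pow_mul]
      rw [c1]
      apply mul_le_mul_of_nonneg_right _ (by positivity)
      have c2 : (2 : ℝ) ≤ 2 ^ m := by
        calc (2 : ℝ) = 2 ^ 1 := by norm_num
          _ ≤ _ := pow_le_pow_right₀ (by norm_num) hm0
      nlinarith
    linarith
  rw [e1, mul_pow, mul_pow]
  have hpos : (0 : ℝ) < 2 ^ M * (m ^ 3) ^ M := by positivity
  calc _ = ((2 : ℝ) * (8 ^ m * 2 ^ (K * m)) * (1 - 1 / (2 * (q : ℝ) ^ 3)) ^ M) * (2 ^ M * (m ^ 3) ^ M) := by ring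
    _ ≤ ((2 : ℝ) * (8 ^ m * 2 ^ (K * m)) * Real.exp (- (m * q / 2))) * (2 ^ M * (m ^ 3) ^ M) := by gcongr
    _ < 1 * (2 ^ M * (m ^ 3) ^ M) := by gcongr
    _ = _ := one_mul _

lemma exists_sparse (h : ℕ) (hh : 1 ≤ h) : ∃ q₀ : ℕ, ∀ q, q₀ ≤ q → ∀ m s, m = q ^ (4 * h) → m = s * q →
    ∃ G : Finset (Fin m × Fin m × Fin m),
      (∀ P ⊆ G, P.Nonempty → P.card ≤ h → 2 * P.card < (P.biUnion coords).card) ∧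
      BoxDense (fun x y z => (x, y, z) ∈ G) s := by
  set K0 := (8 * h ^ 3) ^ h with hK0
  have hK00 : 0 < K0 := by positivity
  set K := h * (2 * h * K0) with hK
  refine ⟨2 * (K + 5), fun q hq m s hm hqs => ?_⟩
  have hq0 : 0 < q := by omega
  have hm0 : 0 < m := by rw [hm]; positivity
  have hmh : 2 * h ≤ m := by
    rw [hm]
    calc 2 * h ≤ 4 * h := by omega
      _ ≤ 2 ^ (4 * h) := Nat.lt_two_pow_self.le
      _ ≤ _ := Nat.pow_le_pow_left (by omega) _
  set M := m * q ^ 4 with hM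
  set L := 2 * h * K0 * m with hL
  have hL0 : 0 < L := by positivity
  have htot : Fintype.card (Fin M → Fin m × Fin m × Fin m) = (m ^ 3) ^ M := by
    simp; ring
  -- Markov
  set Bad1 := univ.filter (fun τ : Fin M → Fin m × Fin m × Fin m => L ≤ (badSets h τ).card) with hBad1
  have hmk : 2 * Bad1.card ≤ (m ^ 3) ^ M := by
    have : (2 * Bad1.card) * L ≤ (m ^ 3) ^ M * L := by
      calc _ = 2 * ∑ τ ∈ Bad1, L := by simp; ring
        _ ≤ 2 * ∑ τ ∈ Bad1, (badSets h τ).card := by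
          apply Nat.mul_le_mul_left
          apply sum_le_sum
          intro τ hτ
          exact (mem_filter.1 hτ).2
        _ ≤ 2 * ∑ τ, (badSets h τ).card := by
          apply Nat.mul_le_mul_left
          exact sum_le_sum_of_subset (subset_univ _)
        _ ≤ 2 * (h * (m * (K0 * (m ^ 3) ^ M))) := by
          apply Nat.mul_le_mul_left
          exact sum_bad m M h q hmh hm0 hq0 hm hM
        _ = _ := by rw [hL]; ring
    exact Nat.le_of_mul_le_mul_right this hL0
  set Bad2 := univ.filter (fun τ : Fin M → Fin m × Fin m × Fin m =>
    ∃ X Y Z : Finset (Fin m), s ≤ X.card ∧ s ≤ Y.card ∧ s ≤ Z.card ∧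
      (univ.filter (fun i => τ i ∈ X ×ˢ (Y ×ˢ Z))).card ≤ K * m) with hBad2
  have hb2 : 2 * Bad2.card < (m ^ 3) ^ M := by
    set Fam : Finset (Finset (Fin m) × Finset (Fin m) × Finset (Fin m)) :=
      univ.filter (fun B => s ≤ B.1.card ∧ s ≤ B.2.1.card ∧ s ≤ B.2.2.card) with hFam
    have hsub : Bad2 ⊆ Fam.biUnion (fun B => univ.filter (fun τ : Fin M → Fin m × Fin m × Fin m =>
        (univ.filter (fun i => τ i ∈ B.1 ×ˢ (B.2.1 ×ˢ B.2.2))).card ≤ K * m)) := by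
      intro τ hτ
      obtain ⟨X, Y, Z, h1, h2, h3, h4⟩ := (mem_filter.1 hτ).2
      rw [mem_biUnion]
      exact ⟨(X, Y, Z), mem_filter.2 ⟨mem_univ _, h1, h2, h3⟩, mem_filter.2 ⟨mem_univ _, h4⟩⟩
    have hcF : Fam.card ≤ 8 ^ m := by
      calc Fam.card ≤ (univ : Finset (Finset (Fin m) × Finset (Fin m) × Finset (Fin m))).card :=
            card_le_card (filter_subset _ _)
        _ = 2 ^ m * (2 ^ m * 2 ^ m) := by simp
        _ = 8 ^ m := by rw [← mul_pow, ← mul_pow]; norm_num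
    have hc : Bad2.card * 2 ^ M ≤ 8 ^ m * (2 ^ (K * m) * (2 * m ^ 3 - s ^ 3) ^ M) := by
      calc _ ≤ _ := Nat.mul_le_mul_right _ ((card_le_card hsub).trans card_biUnion_le)
        _ = _ := sum_mul _ _ _
        _ ≤ ∑ _B ∈ Fam, (2 ^ (K * m) * (2 * m ^ 3 - s ^ 3) ^ M) := by
          apply sum_le_sum
          intro B hB
          obtain ⟨h1, h2, h3⟩ := (mem_filter.1 hB).2
          apply few_hits
          rw [card_product, card_product]
          calc s ^ 3 = s * (s * s) := by ring
            _ ≤ _ := by gcongr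
        _ = Fam.card * (2 ^ (K * m) * (2 * m ^ 3 - s ^ 3) ^ M) := by simp
        _ ≤ _ := Nat.mul_le_mul_right _ hcF
    have hn := numeric_box K m q s M hm0 hqs hM hq
    have : (2 * Bad2.card) * 2 ^ M < (m ^ 3) ^ M * 2 ^ M := by
      rw [mul_comm _ (2 ^ M), mul_comm _ (2 ^ M)]
      rw [mul_comm (Bad2.card)] at hc
      calc _ = 2 * (2 ^ M * Bad2.card) := by ring
        _ ≤ _ := Nat.mul_le_mul_left _ hc
        _ < _ := hn
    exact Nat.lt_of_mul_lt_mul_right this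
  have hex : ∃ τ : Fin M → Fin m × Fin m × Fin m, τ ∉ Bad1 ∪ Bad2 := by
    by_contra hcon
    push Not at hcon
    have h1 : (univ : Finset (Fin M → Fin m × Fin m × Fin m)) ⊆ Bad1 ∪ Bad2 := fun τ _ => hcon τ
    have h2 := (card_le_card h1).trans (card_union_le _ _)
    rw [card_univ, htot] at h2
    omega
  obtain ⟨τ, hτ⟩ := hex
  rw [mem_union, not_or] at hτ
  obtain ⟨hτ1, hτ2⟩ := hτ
  simp only [hBad1, mem_filter, mem_univ, true_and, not_le] at hτ1
  simp only [hBad2, mem_filter, mem_univ, true_and] at hτ2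
  push Not at hτ2
  set D := (badSets h τ).biUnion id with hD
  have hDc : D.card ≤ K * m := by
    calc D.card ≤ ∑ T ∈ badSets h τ, (id T).card := card_biUnion_le
      _ ≤ ∑ T ∈ badSets h τ, h := by
        apply sum_le_sum
        intro T hT
        exact (mem_filter.1 hT).2.1.2
      _ = (badSets h τ).card * h := by simp
      _ ≤ L * h := Nat.mul_le_mul_right _ hτ1.le
      _ = _ := by rw [hL, hK]; ring
  refine ⟨(univ.filter (fun i => i ∉ D)).image τ, ?_, ?_⟩
  · intro P hP hPne hPh
    by_contra hlt
    push Not at hlt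
    have hch : ∀ p ∈ P, ∃ i, i ∉ D ∧ τ i = p := by
      intro p hp
      simpa using hP hp
    haveI : Nonempty (Fin M) := ⟨(hch _ hPne.choose_spec).choose⟩
    choose! idx hidx using hch
    set T := P.image idx with hT
    have hinj : Set.InjOn idx P := by
      intro p hp p' hp' he
      rw [← (hidx p hp).2, ← (hidx p' hp').2, he]
    have hTc : T.card = P.card := card_image_of_injOn hinj
    have hspan : T.biUnion (fun i => coords (τ i)) = P.biUnion coords := by
      rw [hT, image_biUnion]
      apply biUnion_congr rfl
      intro p hp
      rw [(hidx p hp).2]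
    have hbad : T ∈ badSets h τ := by
      refine mem_filter.2 ⟨mem_univ _, ⟨hPne.image _, by omega⟩, ?_⟩
      rw [hspan, hTc]; exact hlt
    obtain ⟨p, hp⟩ := hPne
    apply (hidx p hp).1
    rw [hD, mem_biUnion]
    exact ⟨T, hbad, mem_image_of_mem _ hp⟩
  · intro X Y Z hX hY hZ
    have hh := hτ2 X Y Z hX hY hZ
    have : ¬ (univ.filter (fun i => τ i ∈ X ×ˢ (Y ×ˢ Z))) ⊆ D := by
      intro hsub
      have := card_le_card hsub
      omega
    rw [not_subset] at this
    obtain ⟨i, hi, hiD⟩ := this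
    have hi := (mem_filter.1 hi).2
    simp only [mem_product] at hi
    exact ⟨(τ i).1, hi.1, (τ i).2.1, hi.2.1, (τ i).2.2, hi.2.2, by
      apply mem_image.2
      exact ⟨i, mem_filter.2 ⟨mem_univ _, hiD⟩, rfl⟩⟩

end Sparse

/-! ### Extracting ordered parts -/

section OrderedParts
open Finset

lemma first_split {ι : Type*} [Fintype ι] (i₀ : ι) (k : ℕ) (hk : 1 ≤ k) (S : ι → Finset ℕ)
    (hS : k ≤ (S i₀).card) : ∃ i t, k ≤ ((S i).filter (fun x => x < t)).card ∧
      ∀ j, (S j).card ≤ ((S j).filter (fun x => t ≤ x)).card + k := by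
  classical
  have hex : ∃ t, ∃ i, k ≤ ((S i).filter (fun x => x < t)).card := by
    refine ⟨(S i₀).sup id + 1, i₀, ?_⟩
    rw [filter_true_of_mem]
    · exact hS
    · intro x hx
      exact Nat.lt_succ_of_le (le_sup (f := id) hx)
  obtain ⟨i, hi⟩ := Nat.find_spec hex
  refine ⟨i, Nat.find hex, hi, fun j => ?_⟩
  set t := Nat.find hex with ht
  have hsplit := card_filter_add_card_filter_not (s := S j) (fun x => x < t)
  simp only [not_lt] at hsplit
  suffices h : ((S j).filter (fun x => x < t)).card ≤ k by omega
  rcases Nat.eq_zero_or_pos t with h0 | h0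
  · rw [h0]; simp
  · have hmin := Nat.find_min hex (m := t - 1) (by omega)
    push Not at hmin
    have hj := hmin j
    have hsub : (S j).filter (fun x => x < t) ⊆ insert (t - 1) ((S j).filter (fun x => x < t - 1)) := by
      intro x hx
      simp only [mem_filter, mem_insert] at hx ⊢
      by_cases h : x = t - 1
      · left; exact h
      · right; exact ⟨hx.1, by omega⟩
    have := (card_le_card hsub).trans (card_insert_le _ _)
    omega

lemma two_split (k : ℕ) (hk : 1 ≤ k) (B C : Finset ℕ) (hB : 2 * k ≤ B.card) (hC : 2 * k ≤ C.card) :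
    ∃ B' C' : Finset ℕ, k ≤ B'.card ∧ k ≤ C'.card ∧ (∀ b ∈ B', ∀ c ∈ C', b < c) ∧
      ((B' ⊆ B ∧ C' ⊆ C) ∨ (B' ⊆ C ∧ C' ⊆ B)) := by
  obtain ⟨i, t, h1, h2⟩ := first_split (ι := Bool) true k hk (fun b => if b then B else C)
    (by simp; omega)
  have hb := h2 true
  have hc := h2 false
  simp only [if_true, Bool.false_eq_true, if_false] at hb hc
  cases i with
  | true =>
    refine ⟨B.filter (fun x => x < t), C.filter (fun x => t ≤ x), by simpa using h1, by omega, ?_, ?_⟩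
    · intro b hb c hc
      have := (mem_filter.1 hb).2
      have := (mem_filter.1 hc).2
      omega
    · left; exact ⟨filter_subset _ _, filter_subset _ _⟩
  | false =>
    refine ⟨C.filter (fun x => x < t), B.filter (fun x => t ≤ x), by simpa using h1, by omega, ?_, ?_⟩
    · intro b hb c hc
      have := (mem_filter.1 hb).2
      have := (mem_filter.1 hc).2
      omega
    · right; exact ⟨filter_subset _ _, filter_subset _ _⟩

lemma three_split_aux (k : ℕ) (hk : 1 ≤ k) (t : ℕ) (A B C : Finset ℕ)
    (hA : k ≤ (A.filter (fun x => x < t)).card)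
    (hB : 2 * k ≤ (B.filter (fun x => t ≤ x)).card) (hC : 2 * k ≤ (C.filter (fun x => t ≤ x)).card)
    (R : ℕ → ℕ → ℕ → Prop) (hR2 : ∀ a b c, R a b c → R a c b)
    (h : ∀ a ∈ A, ∀ b ∈ B, ∀ c ∈ C, R a b c) :
    ∃ A' B' C' : Finset ℕ, k ≤ A'.card ∧ k ≤ B'.card ∧ k ≤ C'.card ∧
      A' ⊆ A ∪ B ∪ C ∧ B' ⊆ A ∪ B ∪ C ∧ C' ⊆ A ∪ B ∪ C ∧
      (∀ a ∈ A', ∀ b ∈ B', a < b) ∧ (∀ b ∈ B', ∀ c ∈ C', b < c) ∧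
      ∀ a ∈ A', ∀ b ∈ B', ∀ c ∈ C', R a b c := by
  obtain ⟨B', C', hB', hC', hlt, hor⟩ := two_split k hk _ _ hB hC
  refine ⟨A.filter (fun x => x < t), B', C', hA, hB', hC', ?_, ?_, ?_, ?_, hlt, ?_⟩
  · intro x hx; simp only [mem_union]; left; left; exact (mem_filter.1 hx).1
  · intro x hx
    simp only [mem_union]
    rcases hor with hor | hor
    · left; right; exact (mem_filter.1 (hor.1 hx)).1
    · right; exact (mem_filter.1 (hor.1 hx)).1
  · intro x hx
    simp only [mem_union]
    rcases hor with hor | hor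
    · right; exact (mem_filter.1 (hor.2 hx)).1
    · left; right; exact (mem_filter.1 (hor.2 hx)).1
  · intro a ha b hb
    have h1 := (mem_filter.1 ha).2
    have h2 : t ≤ b := by
      rcases hor with hor | hor
      · exact (mem_filter.1 (hor.1 hb)).2
      · exact (mem_filter.1 (hor.1 hb)).2
    omega
  · intro a ha b hb c hc
    have ha := (mem_filter.1 ha).1
    rcases hor with hor | hor
    · exact h a ha b (mem_filter.1 (hor.1 hb)).1 c (mem_filter.1 (hor.2 hc)).1
    · exact hR2 _ _ _ (h a ha c (mem_filter.1 (hor.2 hc)).1 b (mem_filter.1 (hor.1 hb)).1)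

lemma three_split (k : ℕ) (hk : 1 ≤ k) (A B C : Finset ℕ)
    (hA : 3 * k ≤ A.card) (hB : 3 * k ≤ B.card) (hC : 3 * k ≤ C.card)
    (R : ℕ → ℕ → ℕ → Prop) (hR1 : ∀ a b c, R a b c → R b a c) (hR2 : ∀ a b c, R a b c → R a c b)
    (h : ∀ a ∈ A, ∀ b ∈ B, ∀ c ∈ C, R a b c) :
    ∃ A' B' C' : Finset ℕ, k ≤ A'.card ∧ k ≤ B'.card ∧ k ≤ C'.card ∧
      A' ⊆ A ∪ B ∪ C ∧ B' ⊆ A ∪ B ∪ C ∧ C' ⊆ A ∪ B ∪ C ∧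
      (∀ a ∈ A', ∀ b ∈ B', a < b) ∧ (∀ b ∈ B', ∀ c ∈ C', b < c) ∧
      ∀ a ∈ A', ∀ b ∈ B', ∀ c ∈ C', R a b c := by
  obtain ⟨i, t, h1, h2⟩ := first_split (ι := Fin 3) 0 k hk ![A, B, C] (by simp; omega)
  have ha := h2 0
  have hb := h2 1
  have hc := h2 2
  simp only [Matrix.cons_val] at ha hb hc
  fin_cases i
  · exact three_split_aux k hk t A B C (by simpa using h1) (by omega) (by omega) R hR2 h
  · have := three_split_aux k hk t B A C (by simpa using h1) (by omega) (by omega) R hR2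
      (fun a ha b hb c hc => hR1 _ _ _ (h b hb a ha c hc))
    rwa [union_comm B A] at this
  · have := three_split_aux k hk t C A B (by simpa using h1) (by omega) (by omega) R hR2
      (fun a ha b hb c hc => hR1 _ _ _ (hR2 _ _ _ (h b hb c hc a ha)))
    rwa [union_assoc, union_comm C (A ∪ B)] at this

lemma ordered_blue (N n k : ℕ) (hk : 1 ≤ k) (hn : 3 * k ≤ n) (χ : Finset ℕ → Bool)
    (h : hasMonoCopy N χ (tripartite n n n) false) :
    ∃ α β γ : Fin k → Fin N, Function.Injective α ∧ Function.Injective β ∧ Function.Injective γ ∧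
      (∀ a b, α a < β b) ∧ (∀ b c, β b < γ c) ∧
      ∀ a b c, χ {(α a : ℕ), (β b : ℕ), (γ c : ℕ)} = false := by
  obtain ⟨φ, hinj, hlt, hcol⟩ := h
  have hv : (tripartite n n n).verts = range (n + n + n) := rfl
  rw [hv] at hinj hlt
  have hcard : ∀ u v, v ≤ n + n + n → ((Ico u v).image φ).card = v - u := by
    intro u v hv
    rw [card_image_of_injOn, Nat.card_Ico]
    intro x hx y hy
    apply hinj
    · simp at hx ⊢; omega
    · simp at hy ⊢; omega
  have hmem : ∀ u v, v ≤ n + n + n → ∀ x ∈ (Ico u v).image φ, x < N := by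
    intro u v hv x hx
    obtain ⟨y, hy, rfl⟩ := mem_image.1 hx
    apply hlt
    simp at hy ⊢; omega
  obtain ⟨A, B, C, hA, hB, hC, hA', hB', hC', hAB, hBC, hR⟩ := three_split k hk
    ((Ico 0 n).image φ) ((Ico n (n + n)).image φ) ((Ico (n + n) (n + n + n)).image φ)
    (by rw [hcard] <;> omega) (by rw [hcard] <;> omega) (by rw [hcard] <;> omega)
    (fun a b c => χ {a, b, c} = false)
    (fun a b c h => by rw [insert_comm]; exact h)
    (fun a b c h => by rw [pair_comm]; exact h)
    (by
      intro a ha b hb c hc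
      obtain ⟨x, hx, rfl⟩ := mem_image.1 ha
      obtain ⟨y, hy, rfl⟩ := mem_image.1 hb
      obtain ⟨z, hz, rfl⟩ := mem_image.1 hc
      have hx := mem_Ico.1 hx
      have hy := mem_Ico.1 hy
      have hz := mem_Ico.1 hz
      have := hcol {x, y, z} (by
        simp only [tripartite, mem_filter, mem_powersetCard]
        refine ⟨⟨?_, ?_⟩, ?_, ?_, ?_⟩
        · intro w hw; simp at hw ⊢; omega
        · rw [card_eq_three]; exact ⟨x, y, z, by omega, by omega, by omega, rfl⟩
        · rw [card_eq_one]; refine ⟨x, ?_⟩; ext w; simp; omega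
        · rw [card_eq_one]; refine ⟨y, ?_⟩; ext w; simp; omega
        · rw [card_eq_one]; refine ⟨z, ?_⟩; ext w; simp; omega)
      simpa [image_insert] using this)
  have hall : ∀ x ∈ (Ico 0 n).image φ ∪ (Ico n (n + n)).image φ ∪ (Ico (n + n) (n + n + n)).image φ, x < N := by
    intro x hx
    rw [mem_union, mem_union] at hx
    rcases hx with (hx | hx) | hx
    · exact hmem _ _ (by omega) x hx
    · exact hmem _ _ (by omega) x hx
    · exact hmem _ _ (by omega) x hx
  have enum : ∀ X : Finset ℕ, k ≤ X.card → (∀ x ∈ X, x < N) →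
      ∃ α : Fin k → Fin N, Function.Injective α ∧ ∀ a, (α a : ℕ) ∈ X := by
    intro X hX hXN
    obtain ⟨Y, hY, hYc⟩ := exists_subset_card_eq hX
    refine ⟨fun a => ⟨Y.orderEmbOfFin hYc a, hXN _ (hY (orderEmbOfFin_mem _ _ _))⟩, ?_, ?_⟩
    · intro a b hab
      simpa using hab
    · intro a; exact hY (orderEmbOfFin_mem _ _ _)
  obtain ⟨α, hα, hαA⟩ := enum A hA fun x hx => hall x (hA' hx)
  obtain ⟨β, hβ, hβB⟩ := enum B hB fun x hx => hall x (hB' hx)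
  obtain ⟨γ, hγ, hγC⟩ := enum C hC fun x hx => hall x (hC' hx)
  exact ⟨α, β, γ, hα, hβ, hγ, fun a b => hAB _ (hαA a) _ (hβB b),
    fun b c => hBC _ (hβB b) _ (hγC c), fun a b c => hR _ (hαA a) _ (hβB b) _ (hγC c)⟩

end OrderedParts

/-! ### The random pair coloring -/

section Coloring
open Finset Classical

/-- All positions of pairs between three parts. -/
abbrev Pos (k : ℕ) := (Fin k × Fin k) ⊕ ((Fin k × Fin k) ⊕ (Fin k × Fin k))

/-- Embedding of the positions given three ordered parts. -/
def posMap {N k : ℕ} (α β γ : Fin k → Fin N) : Pos k → Fin N × Fin N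
  | Sum.inl (a, b) => (α a, β b)
  | Sum.inr (Sum.inl (a, c)) => (α a, γ c)
  | Sum.inr (Sum.inr (b, c)) => (β b, γ c)

lemma posMap_injective {N k : ℕ} (α β γ : Fin k → Fin N) (hα : Function.Injective α)
    (hβ : Function.Injective β) (hγ : Function.Injective γ) (hab : ∀ a b, α a < β b)
    (hbc : ∀ b c, β b < γ c) : Function.Injective (posMap α β γ) := by
  rintro (⟨a, b⟩ | ⟨a, b⟩ | ⟨a, b⟩) (⟨a', b'⟩ | ⟨a', b'⟩ | ⟨a', b'⟩) h <;>
    simp only [posMap, Prod.mk.injEq] at h <;> obtain ⟨h1, h2⟩ := h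
  · rw [hα h1, hβ h2]
  · exact absurd h2 (hbc _ _).ne
  · exact absurd h1 (hab _ _).ne
  · exact absurd h2.symm (hbc _ _).ne
  · rw [hα h1, hγ h2]
  · exact absurd h1 (hab _ _).ne
  · exact absurd h1.symm (hab _ _).ne
  · exact absurd h1.symm (hab _ _).ne
  · rw [hβ h1, hγ h2]

lemma bad_one_triple (m s q κ k N : ℕ) (hm0 : 0 < m) (hqs : m = s * q) (hκ : κ = 16 * m ^ 2) (hk : k = 8 * κ)
    (G : Fin m → Fin m → Fin m → Prop) (hG : BoxDense G s)
    (ι : Pos k → Fin N × Fin N) (hι : Function.Injective ι) :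
    (univ.filter (fun g : Fin N × Fin N → Fin m => ∀ a b c,
      ¬ G (g (ι (Sum.inl (a, b)))) (g (ι (Sum.inr (Sum.inr (b, c))))) (g (ι (Sum.inr (Sum.inl (a, c))))))).card
      * q ^ (4 * κ ^ 2) ≤ 32 ^ (k ^ 2) * m ^ (N * N) := by
  have h1 := count_marginal (V := Fin m) ι hι (fun x => ∀ a b c,
      ¬ G (x (Sum.inl (a, b))) (x (Sum.inr (Sum.inr (b, c)))) (x (Sum.inr (Sum.inl (a, c)))))
  have h2 := blue_count G k κ m q s hk (by simp) hm0 hqs hκ hG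
  have h3 : (univ.filter (fun x : Pos k → Fin m => ∀ a b c,
      ¬ G (x (Sum.inl (a, b))) (x (Sum.inr (Sum.inr (b, c)))) (x (Sum.inr (Sum.inl (a, c)))))).card ≤
      (univ.filter (fun p : (Fin k → (Fin k → Fin m) × (Fin k → Fin m)) × (Fin k × Fin k → Fin m) =>
      ∀ a b c, ¬ G ((p.1 a).1 b) (p.2 (b, c)) ((p.1 a).2 c))).card := by
    apply card_le_card_of_injOn (fun x => (fun a => (fun b => x (Sum.inl (a, b)),
      fun c => x (Sum.inr (Sum.inl (a, c)))), fun p => x (Sum.inr (Sum.inr p))))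
    · intro x hx
      simpa using hx
    · intro x _ y _ hxy
      simp only [Prod.mk.injEq] at hxy
      obtain ⟨h4, h5⟩ := hxy
      funext i
      rcases i with ⟨a, b⟩ | ⟨a, b⟩ | p
      · have := congrFun h4 a
        simp only [Prod.mk.injEq] at this
        exact congrFun this.1 b
      · have := congrFun h4 a
        simp only [Prod.mk.injEq] at this
        exact congrFun this.2 b
      · exact congrFun h5 p
  have hc : Fintype.card (Pos k) = 3 * k ^ 2 := by
    simp [Pos]; ring
  rw [hc] at h1
  simp only [Fintype.card_fin, Fintype.card_prod] at h1
  have hpos : 0 < m ^ (3 * k ^ 2) := by positivity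
  apply Nat.le_of_mul_le_mul_right _ hpos
  refine le_trans (b := (univ.filter (fun x : Pos k → Fin m => ∀ a b c,
      ¬ G (x (Sum.inl (a, b))) (x (Sum.inr (Sum.inr (b, c)))) (x (Sum.inr (Sum.inl (a, c)))))).card * m ^ (N * N) * q ^ (4 * κ ^ 2)) ?_ ?_
  · have := Nat.mul_le_mul_right (q ^ (4 * κ ^ 2)) h1
    refine le_trans (le_of_eq ?_) this
    rw [mul_right_comm]
    rfl
  · calc _ ≤ _ := Nat.mul_le_mul_right _ (Nat.mul_le_mul_right _ h3)
      _ = (univ.filter (fun p : (Fin k → (Fin k → Fin m) × (Fin k → Fin m)) × (Fin k × Fin k → Fin m) =>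
      ∀ a b c, ¬ G ((p.1 a).1 b) (p.2 (b, c)) ((p.1 a).2 c))).card * q ^ (4 * κ ^ 2) * m ^ (N * N) := by ring
      _ ≤ _ := Nat.mul_le_mul_right _ h2
      _ = _ := by ring

lemma exists_coloring (m s q k N : ℕ) (hm0 : 0 < m) (hqs : m = s * q) (hk : k = 128 * m ^ 2)
    (hq : 32 ^ 32 ≤ q) (hN : N = q ^ (m ^ 2))
    (G : Fin m → Fin m → Fin m → Prop) (hG : BoxDense G s) :
    ∃ g : Fin N × Fin N → Fin m, ∀ α β γ : Fin k → Fin N, Function.Injective α →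
      Function.Injective β → Function.Injective γ → (∀ a b, α a < β b) → (∀ b c, β b < γ c) →
      ∃ a b c, G (g (α a, β b)) (g (β b, γ c)) (g (α a, γ c)) := by
  by_contra hcon
  push Not at hcon
  set B : (Fin k → Fin N) × (Fin k → Fin N) × (Fin k → Fin N) → Finset (Fin N × Fin N → Fin m) := fun T =>
    if Function.Injective (posMap T.1 T.2.1 T.2.2) then univ.filter (fun g => ∀ a b c,
      ¬ G (g (posMap T.1 T.2.1 T.2.2 (Sum.inl (a, b)))) (g (posMap T.1 T.2.1 T.2.2 (Sum.inr (Sum.inr (b, c)))))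
        (g (posMap T.1 T.2.1 T.2.2 (Sum.inr (Sum.inl (a, c)))))) else ∅ with hB
  have hcov : (univ : Finset (Fin N × Fin N → Fin m)) ⊆ univ.biUnion B := by
    intro g _
    obtain ⟨α, β, γ, h1, h2, h3, h4, h5, h6⟩ := hcon g
    rw [mem_biUnion]
    refine ⟨(α, β, γ), mem_univ _, ?_⟩
    simp only [hB]
    rw [if_pos (posMap_injective α β γ h1 h2 h3 h4 h5)]
    exact mem_filter.2 ⟨mem_univ _, h6⟩
  obtain ⟨κ, hκ⟩ : ∃ κ, κ = 16 * m ^ 2 := ⟨_, rfl⟩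
  have hk8 : k = 8 * κ := by omega
  have hone : ∀ T, (B T).card * q ^ (4 * κ ^ 2) ≤ 32 ^ (k ^ 2) * m ^ (N * N) := by
    intro T
    simp only [hB]
    split_ifs with h
    · exact bad_one_triple m s q κ k N hm0 hqs hκ hk8 G hG _ h
    · simp
  have hcard := (card_le_card hcov).trans card_biUnion_le
  have htot : m ^ (N * N) * q ^ (4 * κ ^ 2) ≤ N ^ (3 * k) * (32 ^ (k ^ 2) * m ^ (N * N)) := by
    calc m ^ (N * N) * q ^ (4 * κ ^ 2) ≤ (∑ T, (B T).card) * q ^ (4 * κ ^ 2) := by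
          apply Nat.mul_le_mul_right
          simpa using hcard
      _ = ∑ T, (B T).card * q ^ (4 * κ ^ 2) := by rw [sum_mul]
      _ ≤ ∑ _T : (Fin k → Fin N) × (Fin k → Fin N) × (Fin k → Fin N), 32 ^ (k ^ 2) * m ^ (N * N) :=
          sum_le_sum fun T _ => hone T
      _ = _ := by
          simp
          left; ring
  have hq1 : 1 < q := lt_of_lt_of_le (by norm_num) hq
  have hmN : 0 < m ^ (N * N) := by positivity
  have h7 : q ^ (4 * κ ^ 2) ≤ N ^ (3 * k) * 32 ^ (k ^ 2) := by
    apply Nat.le_of_mul_le_mul_left _ hmN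
    calc _ ≤ _ := htot
      _ = _ := by ring
  have h8 : 32 ^ (k ^ 2) ≤ q ^ (512 * m ^ 4) := by
    calc 32 ^ (k ^ 2) = (32 ^ 32) ^ (512 * m ^ 4) := by
          rw [← pow_mul, hk]; congr 1; ring
      _ ≤ _ := Nat.pow_le_pow_left hq _
  have h9 : N ^ (3 * k) = q ^ (384 * m ^ 4) := by
    rw [hN, ← pow_mul, hk]; congr 1; ring
  have h10 : q ^ (4 * κ ^ 2) ≤ q ^ (896 * m ^ 4) := by
    calc _ ≤ _ := h7
      _ ≤ q ^ (384 * m ^ 4) * q ^ (512 * m ^ 4) := by rw [h9]; exact Nat.mul_le_mul_left _ h8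
      _ = _ := by rw [← pow_add]; congr 1; ring
  have h11 := (Nat.pow_le_pow_iff_right hq1).1 h10
  have h12 : 4 * κ ^ 2 = 1024 * m ^ 4 := by rw [hκ]; ring
  have h13 : 0 < m ^ 4 := by positivity
  omega

end Coloring

/-! ### Using the hypothesis on the pair density -/

lemma mpair_use (H : ThreeGraph) (hne : H.edges.Nonempty) (hm : mpair H ≥ 1 / 2)
    (ord : ℕ → ℕ) (E : Set (ℕ × ℕ × ℕ)) (f : Finset ℕ → ℕ) (hO : Oriented E)
    (hf : IsPairHom H ord E f) :
    ∃ E' : Finset (Finset ℕ), E' ⊆ H.edges ∧ 0 < imageVerts f E' ∧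
      imageVerts f E' ≤ 2 * imageEdges ord f E' := by
  set S : Set ℝ := {r : ℝ | ∃ E' : Finset (Finset ℕ), E' ⊆ H.edges ∧ E'.Nonempty ∧
      r = (imageEdges ord f E' : ℝ) / (imageVerts f E' : ℝ)} with hS
  have hle : mpair H ≤ sSup S := by
    apply csInf_le
    · refine ⟨0, ?_⟩
      rintro q ⟨ord, E, f, _, _, rfl⟩
      apply Real.sSup_nonneg
      rintro r ⟨E', _, _, rfl⟩
      positivity
    · exact ⟨ord, E, f, hO, hf, rfl⟩
  have hfin : S.Finite := by
    apply ((H.edges.powerset : Finset (Finset (Finset ℕ))).finite_toSet.image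
      (fun E' => (imageEdges ord f E' : ℝ) / (imageVerts f E' : ℝ))).subset
    rintro r ⟨E', h1, _, rfl⟩
    exact ⟨E', by simpa using h1, rfl⟩
  have hSne : S.Nonempty := ⟨_, H.edges, subset_rfl, hne, rfl⟩
  obtain ⟨E', h1, _, h3⟩ := hSne.csSup_mem hfin
  have h4 : (1 / 2 : ℝ) ≤ (imageEdges ord f E' : ℝ) / (imageVerts f E' : ℝ) := by
    rw [← h3]; linarith
  have hpos : 0 < imageVerts f E' := by
    rcases Nat.eq_zero_or_pos (imageVerts f E') with h | h
    · rw [h] at h4; norm_num at h4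
    · exact h
  refine ⟨E', h1, hpos, ?_⟩
  have hpos' : (0 : ℝ) < imageVerts f E' := by exact_mod_cast hpos
  rw [le_div_iff₀ hpos'] at h4
  have : (imageVerts f E' : ℝ) ≤ 2 * imageEdges ord f E' := by linarith
  exact_mod_cast this

section Red
open Finset Classical

/-- The triple of natural numbers underlying a triple. -/
def vals {m : ℕ} (t : Fin m × Fin m × Fin m) : ℕ × ℕ × ℕ := (t.1.val, t.2.1.val, t.2.2.val)

lemma vals_injective {m : ℕ} : Function.Injective (vals : Fin m × Fin m × Fin m → ℕ × ℕ × ℕ) := by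
  rintro ⟨a, b, c⟩ ⟨a', b', c'⟩ h
  simp only [vals, Prod.mk.injEq] at h
  simp [Fin.ext_iff, h]

/-- The oriented 3-graph on the naturals. -/
def valE {m : ℕ} (G : Finset (Fin m × Fin m × Fin m)) : Set (ℕ × ℕ × ℕ) :=
  {p | ∃ t ∈ G, p = vals t}

/-- The pair coloring on naturals. -/
def natPair {N m : ℕ} (g : Fin N × Fin N → Fin m) (u v : ℕ) : ℕ :=
  if h : u < N ∧ v < N then (g (⟨u, h.1⟩, ⟨v, h.2⟩)).val else 0

/-- The triple coloring. -/
noncomputable def chi {N m : ℕ} (g : Fin N × Fin N → Fin m) (G : Finset (Fin m × Fin m × Fin m))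
    (e : Finset ℕ) : Bool :=
  decide (∃ u v w, u < v ∧ v < w ∧ w < N ∧ e = {u, v, w} ∧
    (natPair g u v, natPair g v w, natPair g u w) ∈ valE G)

lemma valE_oriented {m h : ℕ} (hh : 2 ≤ h) (G : Finset (Fin m × Fin m × Fin m))
    (hG : ∀ P ⊆ G, P.Nonempty → P.card ≤ h → 2 * P.card < (P.biUnion coords).card) :
    Oriented (valE G) := by
  have hc3 : ∀ t : Fin m × Fin m × Fin m, (coords t).card ≤ 3 := fun t => card_le_three
  have huniq : ∀ t ∈ G, ∀ t' ∈ G, coords t' ⊆ coords t → t = t' := by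
    intro t ht t' ht' hsub
    by_contra hne
    have h1 := hG {t, t'} (by intro x hx; simp at hx; rcases hx with rfl | rfl <;> assumption)
      (by simp) (by rw [card_pair hne]; exact hh)
    rw [card_pair hne] at h1
    have h2 : ({t, t'} : Finset (Fin m × Fin m × Fin m)).biUnion coords ⊆ coords t := by
      intro x hx
      simp only [mem_biUnion, mem_insert, mem_singleton] at hx
      obtain ⟨y, rfl | rfl, hy⟩ := hx
      · exact hy
      · exact hsub hy
    have := card_le_card h2
    have := hc3 t
    omega
  rintro a b c ⟨⟨x, y, z⟩, ht, hp⟩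
  simp only [vals, Prod.mk.injEq] at hp
  obtain ⟨rfl, rfl, rfl⟩ := hp
  have h1 := hG {(x, y, z)} (by simpa using ht) (by simp) (by simp; omega)
  simp only [card_singleton, singleton_biUnion, coords] at h1
  have hxy : x ≠ y := by
    rintro rfl
    have : ({x, x, z} : Finset (Fin m)).card ≤ 2 := by simpa using card_le_two
    omega
  have hyz : y ≠ z := by
    rintro rfl
    have : ({x, y, y} : Finset (Fin m)).card ≤ 2 := by simpa using card_le_two
    omega
  have hxz : x ≠ z := by
    rintro rfl
    have : ({x, y, x} : Finset (Fin m)).card ≤ 2 := by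
      rw [Finset.insert_eq_of_mem (by simp)]; exact card_le_two
    omega
  refine ⟨⟨by simpa [Fin.ext_iff] using hxy, by simpa [Fin.ext_iff] using hyz,
    by simpa [Fin.ext_iff] using hxz⟩, ?_, ?_, ?_, ?_, ?_⟩ <;>
  · rintro ⟨⟨x', y', z'⟩, ht', hp⟩
    simp only [vals, Prod.mk.injEq, Fin.val_inj] at hp
    obtain ⟨rfl, rfl, rfl⟩ := hp
    have := huniq _ ht _ ht' (by intro q hq; simp only [coords, mem_insert, mem_singleton] at hq ⊢; tauto)
    simp only [Prod.mk.injEq] at this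
    grind

lemma sorted_unique {a b c a' b' c' : ℕ} (h1 : a < b) (h2 : b < c) (h1' : a' < b') (h2' : b' < c')
    (h : ({a, b, c} : Finset ℕ) = {a', b', c'}) : a = a' ∧ b = b' ∧ c = c' := by
  have ha : a ∈ ({a', b', c'} : Finset ℕ) := h ▸ (by simp)
  have hb : b ∈ ({a', b', c'} : Finset ℕ) := h ▸ (by simp)
  have hc : c ∈ ({a', b', c'} : Finset ℕ) := h ▸ (by simp)
  simp only [mem_insert, mem_singleton] at ha hb hc
  omega

lemma red_free (H : ThreeGraph) (hne : H.edges.Nonempty) (hm : mpair H ≥ 1 / 2) (m N h : ℕ)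
    (hh : h = H.verts.card ^ 3 + 2) (G : Finset (Fin m × Fin m × Fin m))
    (hG : ∀ P ⊆ G, P.Nonempty → P.card ≤ h → 2 * P.card < (P.biUnion coords).card)
    (g : Fin N × Fin N → Fin m) : ¬ hasMonoCopy N (chi g G) H true := by
  rintro ⟨φ, hinj, hlt, hmono⟩
  have hO := valE_oriented (by omega) G hG
  set f : Finset ℕ → ℕ := fun s => natPair g (s.sum φ - s.sup φ) (s.sup φ) with hf
  have hfp : ∀ u v, φ u < φ v → f {u, v} = natPair g (φ u) (φ v) := by
    intro u v huv
    have hne : u ≠ v := by rintro rfl; omega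
    have h1 : ({u, v} : Finset ℕ).sup φ = φ v := by simp; omega
    simp only [hf]
    rw [h1, sum_pair hne, Nat.add_sub_cancel]
  have hmem : ∀ e ∈ H.edges, ∀ u v w : ℕ, e = {u, v, w} → φ u < φ v → φ v < φ w →
      (f {u, v}, f {v, w}, f {u, w}) ∈ valE G := by
    intro e he u v w hee huv hvw
    have h1 := hmono e he
    simp only [chi, decide_eq_true_eq] at h1
    obtain ⟨u', v', w', h2, h3, _, h5, h6⟩ := h1
    rw [hee] at h5
    simp only [image_insert, image_singleton] at h5
    obtain ⟨rfl, rfl, rfl⟩ := sorted_unique huv hvw h2 h3 h5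
    rw [hfp u v huv, hfp v w hvw, hfp u w (huv.trans hvw)]
    exact h6
  have hhom : IsPairHom H φ (valE G) f := by
    refine ⟨hinj, fun e he u v w hee huv hvw => ?_⟩
    have h1 := hmem e he u v w hee huv hvw
    have h2 := (hO _ _ _ h1).1
    exact ⟨⟨h2.1, h2.2.1, h2.2.2⟩, h1⟩
  obtain ⟨E', hE', hpos, hle⟩ := mpair_use H hne hm φ (valE G) f hO hhom
  set P : Set (ℕ × ℕ × ℕ) := {p : ℕ × ℕ × ℕ | ∃ e ∈ E', ∃ u v w : ℕ,
    e = ({u, v, w} : Finset ℕ) ∧ φ u < φ v ∧ φ v < φ w ∧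
    p = (f {u, v}, f {v, w}, f {u, w})} with hP
  have hie : imageEdges φ f E' = P.ncard := rfl
  set PF := G.filter (fun t => vals t ∈ P) with hPF
  have himg : ((PF.image vals : Finset (ℕ × ℕ × ℕ)) : Set (ℕ × ℕ × ℕ)) = P := by
    ext p
    simp only [coe_image, Set.mem_image, mem_coe, hPF, mem_filter]
    constructor
    · rintro ⟨t, ⟨_, h1⟩, rfl⟩; exact h1
    · intro hp
      obtain ⟨e, he, u, v, w, hee, huv, hvw, rfl⟩ := hp
      obtain ⟨t, ht, hte⟩ := hmem e (hE' he) u v w hee huv hvw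
      exact ⟨t, ⟨ht, hte ▸ ⟨e, he, u, v, w, hee, huv, hvw, rfl⟩⟩, hte.symm⟩
  have hcard : PF.card = imageEdges φ f E' := by
    rw [hie, ← himg, Set.ncard_coe_finset, card_image_of_injective _ vals_injective]
  have hsmall : PF.card ≤ h := by
    have h1 : PF.image vals ⊆ (H.verts ×ˢ (H.verts ×ˢ H.verts)).image
        (fun x => (f {x.1, x.2.1}, f {x.2.1, x.2.2}, f {x.1, x.2.2})) := by
      intro p hp
      have hp' : p ∈ P := by rw [← himg]; exact hp
      obtain ⟨e, he, u, v, w, hee, huv, hvw, rfl⟩ := hp'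
      have hsub := H.subset_verts e (hE' he)
      rw [mem_image]
      refine ⟨(u, v, w), ?_, rfl⟩
      simp only [mem_product]
      exact ⟨hsub (by simp [hee]), hsub (by simp [hee]), hsub (by simp [hee])⟩
    have h2 := (card_le_card h1).trans card_image_le
    rw [card_image_of_injective _ vals_injective, card_product, card_product] at h2
    calc PF.card ≤ _ := h2
      _ = H.verts.card ^ 3 := by ring
      _ ≤ h := by omega
  have hPFne : PF.Nonempty := by
    rw [← card_pos]; omega
  have h1 := hG PF (filter_subset _ _) hPFne hsmall
  have h2 : (PF.biUnion coords).card ≤ imageVerts f E' := by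
    apply card_le_card_of_injOn (fun x => x.val) _ (Fin.val_injective.injOn)
    intro x hx
    simp only [mem_coe, mem_biUnion] at hx
    obtain ⟨t, ht, hxt⟩ := hx
    obtain ⟨e, he, u, v, w, hee, huv, hvw, hte⟩ := (mem_filter.1 ht).2
    have key : ∀ y z, y ∈ e → z ∈ e → y ≠ z → f {y, z} ∈ (shadowOf E').image f := by
      intro y z hy hz hyz
      apply mem_image_of_mem
      simp only [shadowOf, mem_biUnion, mem_powersetCard]
      refine ⟨e, he, ?_, card_pair hyz⟩
      intro q hq
      simp only [mem_insert, mem_singleton] at hq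
      rcases hq with rfl | rfl <;> assumption
    have huv' : u ≠ v := by rintro rfl; omega
    have hvw' : v ≠ w := by rintro rfl; omega
    have huw' : u ≠ w := by rintro rfl; omega
    simp only [vals, Prod.mk.injEq] at hte
    simp only [coords, mem_insert, mem_singleton] at hxt
    simp only [mem_coe]
    rcases hxt with rfl | rfl | rfl
    · rw [hte.1]; exact key u v (by simp [hee]) (by simp [hee]) huv'
    · rw [hte.2.1]; exact key v w (by simp [hee]) (by simp [hee]) hvw'
    · rw [hte.2.2]; exact key u w (by simp [hee]) (by simp [hee]) huw'
  omega

end Red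

/-! ### Conclusion -/

section Conclusion
open Classical

lemma lower_core (H : ThreeGraph) (hne : H.edges.Nonempty) (hm : mpair H ≥ 1 / 2) :
    ∃ h : ℕ, 1 ≤ h ∧ ∃ q₀ : ℕ, ∀ q, q₀ ≤ q → ∀ n, 384 * q ^ (8 * h) ≤ n →
      q ^ (q ^ (8 * h)) < ramsey H (tripartite n n n) := by
  obtain ⟨h, hh⟩ : ∃ h, h = H.verts.card ^ 3 + 2 := ⟨_, rfl⟩
  obtain ⟨q₀, hq₀⟩ := exists_sparse h (by omega)
  refine ⟨h, by omega, max q₀ (32 ^ 32), fun q hq n hn => ?_⟩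
  have hq1 : q₀ ≤ q := (le_max_left _ _).trans hq
  have hq2 : 32 ^ 32 ≤ q := (le_max_right _ _).trans hq
  have hq3 : 0 < q := lt_of_lt_of_le (by norm_num) hq2
  obtain ⟨m, hmq⟩ : ∃ m, m = q ^ (4 * h) := ⟨_, rfl⟩
  obtain ⟨s, hs⟩ : ∃ s, s = q ^ (4 * h - 1) := ⟨_, rfl⟩
  have hms : m = s * q := by
    rw [hmq, hs, ← pow_succ]; congr 1; omega
  have hm0 : 0 < m := by rw [hmq]; positivity
  have hm2 : m ^ 2 = q ^ (8 * h) := by rw [hmq, ← pow_mul]; congr 1; ring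
  obtain ⟨G, hG1, hG2⟩ := hq₀ q hq1 m s hmq hms
  obtain ⟨k, hk⟩ : ∃ k, k = 128 * m ^ 2 := ⟨_, rfl⟩
  obtain ⟨N, hN⟩ : ∃ N, N = q ^ (m ^ 2) := ⟨_, rfl⟩
  obtain ⟨g, hg⟩ := exists_coloring m s q k N hm0 hms hk hq2 hN _ hG2
  rw [← hm2, ← hN]
  apply lt_ramsey H _ N (chi g G) (red_free H hne hm m N h hh G hG1 g)
  intro hblue
  have hm20 : 0 < m ^ 2 := by positivity
  rw [← hm2] at hn
  obtain ⟨α, β, γ, h1, h2, h3, h4, h5, h6⟩ := ordered_blue N n k (by omega) (by omega) _ hblue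
  obtain ⟨a, b, c, habc⟩ := hg α β γ h1 h2 h3 h4 h5
  have h7 := h6 a b c
  simp only [chi, decide_eq_false_iff_not] at h7
  apply h7
  refine ⟨α a, β b, γ c, h4 a b, h5 b c, (γ c).2, rfl, _, habc, ?_⟩
  simp [natPair, vals]

lemma final_numerics (h : ℕ) (hh : 1 ≤ h) (q₀ : ℕ) (r : ℕ → ℕ)
    (hr : ∀ q, q₀ ≤ q → ∀ n, 384 * q ^ (8 * h) ≤ n → q ^ (q ^ (8 * h)) < r n) :
    ∃ c : ℝ, c > 0 ∧ ∃ n₀ : ℕ, ∀ n : ℕ, n₀ ≤ n →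
      (r n : ℝ) ≥ (2 : ℝ) ^ (c * n * Real.log n) := by
  refine ⟨1 / (384 * 2 ^ (8 * h) * (16 * h + 9)), by positivity, 384 * (q₀ + 2) ^ (8 * h), fun n hn => ?_⟩
  have hh0 : 8 * h ≠ 0 := by omega
  -- choose the largest admissible q
  obtain ⟨q, hq1, hq2, hq3⟩ : ∃ q, q₀ + 2 ≤ q ∧ 384 * q ^ (8 * h) ≤ n ∧ n < 384 * (q + 1) ^ (8 * h) := by
    have hex : ∃ t, n < 384 * (t + 1) ^ (8 * h) := ⟨n, by
      have := Nat.le_self_pow hh0 (n + 1)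
      omega⟩
    refine ⟨Nat.find hex, ?_, ?_, Nat.find_spec hex⟩
    · by_contra hlt
      have hlt' : Nat.find hex + 1 ≤ q₀ + 2 := by omega
      have h1 := Nat.find_spec hex
      have h2 := Nat.pow_le_pow_left hlt' (8 * h)
      omega
    · rcases Nat.eq_zero_or_pos (Nat.find hex) with h0 | h0
      · rw [h0, zero_pow hh0]; omega
      · have h1 := Nat.find_min hex (m := Nat.find hex - 1) (by omega)
        rw [Nat.sub_add_cancel h0] at h1
        omega
  have hlow := hr q (by omega) n hq2
  have hqR : (2 : ℝ) ≤ q := by exact_mod_cast (by omega : 2 ≤ q)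
  have hlq : 0 < Real.log q := Real.log_pos (by linarith)
  have hn0 : 0 < n := by
    have : 0 < q ^ (8 * h) := by have : 0 < q := by omega
                                 positivity
    omega
  have hnR : (1 : ℝ) ≤ n := by exact_mod_cast hn0
  have hln : 0 ≤ Real.log n := Real.log_nonneg hnR
  have hn1 : (n : ℝ) ≤ 384 * 2 ^ (8 * h) * (q : ℝ) ^ (8 * h) := by
    have h1 : (n : ℝ) ≤ 384 * ((q : ℝ) + 1) ^ (8 * h) := by exact_mod_cast hq3.le
    have h2 : ((q : ℝ) + 1) ^ (8 * h) ≤ (2 * q) ^ (8 * h) := by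
      apply pow_le_pow_left₀ (by linarith); linarith
    rw [mul_pow] at h2
    linarith
  have hn2 : Real.log n ≤ (16 * h + 9) * Real.log q := by
    have h1 : (n : ℝ) ≤ (q : ℝ) ^ (16 * h + 9) := by
      have h2 : (2 : ℝ) ^ (8 * h) ≤ (q : ℝ) ^ (8 * h) := pow_le_pow_left₀ (by norm_num) hqR _
      have h3 : (2 : ℝ) ^ 9 ≤ (q : ℝ) ^ 9 := pow_le_pow_left₀ (by norm_num) hqR _
      calc (n : ℝ) ≤ _ := hn1
        _ ≤ (q : ℝ) ^ 9 * (q : ℝ) ^ (8 * h) * (q : ℝ) ^ (8 * h) := by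
            gcongr
            linarith
        _ = _ := by ring
    calc Real.log n ≤ Real.log ((q : ℝ) ^ (16 * h + 9)) := Real.log_le_log (by linarith) h1
      _ = _ := by rw [Real.log_pow]; push_cast; ring
  have hbig : (2 : ℝ) ^ (1 / (384 * 2 ^ (8 * h) * (16 * h + 9)) * n * Real.log n) ≤ (q : ℝ) ^ (q ^ (8 * h)) := by
    have hq0 : (0 : ℝ) < q := by linarith
    rw [← Real.rpow_natCast (q : ℝ) (q ^ (8 * h)), Real.rpow_def_of_pos (by norm_num), Real.rpow_def_of_pos hq0, Real.exp_le_exp]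
    have hl2 : Real.log 2 ≤ 1 := by linarith [Real.log_two_lt_d9]
    have hl20 : 0 ≤ Real.log 2 := Real.log_nonneg (by norm_num)
    have hD : (0 : ℝ) < 384 * 2 ^ (8 * h) * (16 * h + 9) := by positivity
    have h1 : (n : ℝ) * Real.log n ≤ (384 * 2 ^ (8 * h) * (q : ℝ) ^ (8 * h)) * ((16 * h + 9) * Real.log q) :=
      mul_le_mul hn1 hn2 hln (by positivity)
    have h2 : 1 / (384 * 2 ^ (8 * h) * (16 * h + 9)) * n * Real.log n ≤ (q : ℝ) ^ (8 * h) * Real.log q := by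
      rw [mul_assoc, one_div, inv_mul_le_iff₀ hD]
      calc _ ≤ _ := h1
        _ = _ := by ring
    have h3 : 0 ≤ 1 / (384 * 2 ^ (8 * h) * (16 * h + 9)) * n * Real.log n := by positivity
    push_cast
    calc _ ≤ 1 * (1 / (384 * 2 ^ (8 * h) * (16 * h + 9)) * n * Real.log n) := by gcongr
      _ ≤ _ := by rw [one_mul, mul_comm (Real.log (q : ℝ))]; exact h2
  have hlow' : ((q : ℝ)) ^ (q ^ (8 * h)) ≤ (r n : ℝ) := by exact_mod_cast hlow.le
  exact hbig.trans hlow'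

end Conclusion

/-- If `H` is a nonempty 3-graph with `m_pair(H) ≥ 1/2`, then
`r(H, K_{n,n,n}^{(3)}) ≥ 2^{c n log n}` for some `c > 0` and all sufficiently large `n`. -/
theorem mpair_half_ramsey_lower (H : ThreeGraph) (hne : H.edges.Nonempty)
    (hm : mpair H ≥ 1 / 2) :
    ∃ c : ℝ, c > 0 ∧ ∃ n₀ : ℕ, ∀ n : ℕ, n₀ ≤ n →
      (ramsey H (tripartite n n n) : ℝ) ≥ (2 : ℝ) ^ (c * n * Real.log n) := by
  obtain ⟨h, hh, q₀, hq⟩ := lower_core H hne hm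
  exact final_numerics h hh q₀ (fun n => ramsey H (tripartite n n n)) hq
end

section
/- Let H be a 3-graph whose edges can be ordered e_1, ..., e_m so that for each i, the edge e_i contains at least one 2-element subset not contained in any of e_1, ..., e_{i−1} (that is, H can be created by starting with the empty 3-graph and iteratively adding edges that strictly increase the number of edges in the shadow at each step). Then there exists a constant C > 0 depending only on H such that for all n ≥ 2, r(H, K_{n,n,n}^(3)) ≤ 2^{C n log n} (log denotes the natural logarithm). -/
open Finset

lemma choose_lower (a k n : ℕ) (h : a ≤ 2 * k) (ha : 4 * n ≤ a) :
    a ^ n ≤ (4 * n) ^ n * k.choose n := by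
  have h1 := Nat.pow_sub_le_descFactorial k n
  rw [Nat.descFactorial_eq_factorial_mul_choose] at h1
  have h2 : a ≤ 4 * (k + 1 - n) := by omega
  calc a ^ n ≤ (4 * (k + 1 - n)) ^ n := Nat.pow_le_pow_left h2 n
    _ = 4 ^ n * (k + 1 - n) ^ n := by rw [mul_pow]
    _ ≤ 4 ^ n * (n.factorial * k.choose n) := by gcongr
    _ ≤ 4 ^ n * (n ^ n * k.choose n) := by gcongr; exact Nat.factorial_le_pow n
    _ = _ := by rw [mul_pow]; ring

open Classical in
lemma good_count {α : Type*} (A B : Finset α) (R : α → α → Prop) (n : ℕ) (hn : 1 ≤ n)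
    (hA : 4 * n ≤ #A) (hB : 4 * n ≤ #B)
    (h : 4 * n * (∑ x ∈ A, #{y ∈ B | R x y}) < #A * #B) :
    #A ^ n * #B ^ n ≤ (4 * n) ^ (2 * n) *
      #{p ∈ powersetCard n A ×ˢ powersetCard n B | ∀ x ∈ p.1, ∀ y ∈ p.2, ¬ R x y} := by
  set A' := {x ∈ A | 2 * n * #{y ∈ B | R x y} ≤ #B} with hA'
  have hA2 : #A ≤ 2 * #A' := by
    by_contra hc
    have hsplit : #A' + #{x ∈ A | ¬ 2 * n * #{y ∈ B | R x y} ≤ #B} = #A :=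
      card_filter_add_card_filter_not _
    set A'' := {x ∈ A | ¬ 2 * n * #{y ∈ B | R x y} ≤ #B} with hA''
    have h1 : #A'' * #B ≤ 2 * n * (∑ x ∈ A, #{y ∈ B | R x y}) := by
      rw [mul_sum]
      calc #A'' * #B = ∑ x ∈ A'', #B := by simp
        _ ≤ ∑ x ∈ A'', 2 * n * #{y ∈ B | R x y} := by
          apply sum_le_sum
          intro x hx
          simp only [hA'', mem_filter] at hx
          omega
        _ ≤ _ := sum_le_sum_of_subset (filter_subset _ _)
    have h2 : #A ≤ 2 * #A'' := by omega
    nlinarith [Nat.mul_le_mul_right (#B) h2]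
  have hB' : ∀ X ∈ powersetCard n A', #B ≤ 2 * #{y ∈ B | ∀ x ∈ X, ¬ R x y} := by
    intro X hX
    rw [mem_powersetCard] at hX
    have hsplit : #{y ∈ B | ∀ x ∈ X, ¬ R x y} + #{y ∈ B | ¬ ∀ x ∈ X, ¬ R x y} = #B :=
      card_filter_add_card_filter_not _
    have h1 : #{y ∈ B | ¬ ∀ x ∈ X, ¬ R x y} ≤ ∑ x ∈ X, #{y ∈ B | R x y} := by
      refine le_trans (card_le_card ?_) card_biUnion_le
      intro y hy
      simp only [mem_filter, mem_biUnion] at hy ⊢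
      push Not at hy
      obtain ⟨hy, x, hx, hr⟩ := hy
      exact ⟨x, hx, hy, hr⟩
    have h2 : 2 * n * ∑ x ∈ X, #{y ∈ B | R x y} ≤ n * #B := by
      rw [mul_sum, ← hX.2, ← smul_eq_mul (#X) (#B)]
      apply sum_le_card_nsmul
      intro x hx
      have := hX.1 hx
      simp only [hA', mem_filter] at this
      rw [hX.2]; exact this.2
    have h3 : 2 * ∑ x ∈ X, #{y ∈ B | R x y} ≤ #B := by
      apply Nat.le_of_mul_le_mul_left _ hn
      linarith
    omega
  have hcount : ∑ X ∈ powersetCard n A', (#{y ∈ B | ∀ x ∈ X, ¬ R x y}).choose n ≤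
      #{p ∈ powersetCard n A ×ˢ powersetCard n B | ∀ x ∈ p.1, ∀ y ∈ p.2, ¬ R x y} := by
    calc _ = ∑ X ∈ powersetCard n A', #(powersetCard n {y ∈ B | ∀ x ∈ X, ¬ R x y}) := by
          simp only [card_powersetCard]
      _ = #((powersetCard n A').sigma fun X => powersetCard n {y ∈ B | ∀ x ∈ X, ¬ R x y}) := by
          rw [card_sigma]
      _ ≤ _ := by
        apply card_le_card_of_injOn (fun p => (p.1, p.2))
        · rintro ⟨X, Y⟩ hp
          simp only [coe_sigma, Set.mem_sigma_iff, mem_coe, mem_powersetCard] at hp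
          simp only [coe_filter, Set.mem_ofPred_eq, mem_product, mem_powersetCard]
          obtain ⟨⟨h1, h2⟩, h3, h4⟩ := hp
          refine ⟨⟨⟨h1.trans (filter_subset _ _), h2⟩, h3.trans (filter_subset _ _), h4⟩, ?_⟩
          intro x hx y hy
          exact (mem_filter.1 (h3 hy)).2 x hx
        · rintro ⟨X, Y⟩ _ ⟨X', Y'⟩ _ h
          simp at h
          simp [h.1, h.2]
  have hc2 : (4 * n) ^ n * ∑ X ∈ powersetCard n A', (#{y ∈ B | ∀ x ∈ X, ¬ R x y}).choose n
      ≥ (#A').choose n * #B ^ n := by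
    rw [mul_sum, ← card_powersetCard, ← smul_eq_mul (#_) (#B ^ n)]
    apply card_nsmul_le_sum
    intro X hX
    exact choose_lower _ _ _ (hB' X hX) hB
  have hc3 := choose_lower _ _ n hA2 hA
  calc #A ^ n * #B ^ n ≤ (4 * n) ^ n * (#A').choose n * #B ^ n := by gcongr
    _ = (4 * n) ^ n * ((#A').choose n * #B ^ n) := by ring
    _ ≤ (4 * n) ^ n * ((4 * n) ^ n * ∑ X ∈ powersetCard n A', (#{y ∈ B | ∀ x ∈ X, ¬ R x y}).choose n) := by gcongr
    _ ≤ (4 * n) ^ n * ((4 * n) ^ n * #{p ∈ powersetCard n A ×ˢ powersetCard n B | ∀ x ∈ p.1, ∀ y ∈ p.2, ¬ R x y}) := by gcongr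
    _ = _ := by rw [two_mul, pow_add]; ring

open Classical in
lemma local_count {α : Type*} [Fintype α] (n q : ℕ) (hn : 1 ≤ n) (hq : 1 ≤ q)
    (hM : (4 * n * q) ^ (2 * n + 1) ≤ Fintype.card α)
    (A B : α → Finset α) (R : α → α → α → Prop)
    (hfree : ∀ X Y Z : Finset α, #X = n → #Y = n → #Z = n →
      ∃ x ∈ X, ∃ y ∈ Y, ∃ z ∈ Z, R z x y) :
    q * ∑ z, #(A z) * #(B z) ≤ 2 * Fintype.card α ^ 3 +
      4 * n * q * ∑ z, ∑ x ∈ A z, #{y ∈ B z | R z x y} := by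
  set M := Fintype.card α with hMdef
  set r : α → ℕ := fun z => ∑ x ∈ A z, #{y ∈ B z | R z x y} with hr
  have hMpos : 1 ≤ M := le_trans (Nat.one_le_pow _ _ (by positivity)) hM
  have hM1 : 4 * n * q ≤ M := le_trans (Nat.le_self_pow (by omega) _) hM
  set G : Finset α := {z | M ^ 2 < q * (#(A z) * #(B z)) ∧ 4 * n * r z < #(A z) * #(B z)} with hG
  have hAM : ∀ z, #(A z) ≤ M := fun z => card_le_univ _
  have hBM : ∀ z, #(B z) ≤ M := fun z => card_le_univ _
  have hGcard : q * #G ≤ M := by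
    by_contra hc
    push Not at hc
    -- the pairs of n-sets
    let P : Finset (Finset α × Finset α) :=
      powersetCard n (univ : Finset α) ×ˢ powersetCard n (univ : Finset α)
    have hP : #P ≤ M ^ (2 * n) := by
      simp only [P, card_product, card_powersetCard, card_univ]
      rw [two_mul, pow_add]
      exact Nat.mul_le_mul (Nat.choose_le_pow _ _) (Nat.choose_le_pow _ _)
    let rel : α → Finset α × Finset α → Prop := fun z p =>
      p.1 ⊆ A z ∧ p.2 ⊆ B z ∧ ∀ x ∈ p.1, ∀ y ∈ p.2, ¬ R z x y
    have hdc := sum_card_bipartiteAbove_eq_sum_card_bipartiteBelow (s := G) (t := P) rel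
    have hup : ∑ p ∈ P, #(bipartiteBelow rel G p) ≤ M ^ (2 * n) * n := by
      refine le_trans (sum_le_card_nsmul _ _ n ?_) (by rw [smul_eq_mul]; gcongr)
      rintro ⟨X, Y⟩ hp
      by_contra hlt
      push Not at hlt
      obtain ⟨Z, hZ, hZc⟩ := exists_subset_card_eq hlt.le
      simp only [P, mem_product, mem_powersetCard] at hp
      obtain ⟨x, hx, y, hy, z, hz, h⟩ := hfree X Y Z hp.1.2 hp.2.2 hZc
      have := hZ hz
      simp only [mem_bipartiteBelow, rel] at this
      exact this.2.2.2 x hx y hy h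
    have hlow : ∀ z ∈ G, M ^ (2 * n) ≤ (4 * n * q) ^ (2 * n) * #(bipartiteAbove rel P z) := by
      intro z hz
      simp only [hG, mem_filter, mem_univ, true_and] at hz
      have ha : M ≤ q * #(A z) := by
        have := Nat.mul_le_mul_left (q * #(A z)) (hBM z)
        by_contra hc
        nlinarith
      have hb : M ≤ q * #(B z) := by
        have := Nat.mul_le_mul_left (q * #(B z)) (hAM z)
        by_contra hc
        nlinarith
      have ha4 : 4 * n ≤ #(A z) := by
        apply Nat.le_of_mul_le_mul_left _ hq
        linarith
      have hb4 : 4 * n ≤ #(B z) := by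
        apply Nat.le_of_mul_le_mul_left _ hq
        linarith
      have hgc := good_count (A z) (B z) (R z) n hn ha4 hb4 hz.2
      have hle : #{p ∈ powersetCard n (A z) ×ˢ powersetCard n (B z) |
          ∀ x ∈ p.1, ∀ y ∈ p.2, ¬ R z x y} ≤ #(bipartiteAbove rel P z) := by
        apply card_le_card
        rintro ⟨X, Y⟩ hp
        simp only [mem_filter, mem_product, mem_powersetCard] at hp
        simp only [mem_bipartiteAbove, rel, P, mem_product, mem_powersetCard]
        exact ⟨⟨⟨subset_univ _, hp.1.1.2⟩, subset_univ _, hp.1.2.2⟩, hp.1.1.1, hp.1.2.1, hp.2⟩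
      calc M ^ (2 * n) = M ^ n * M ^ n := by rw [two_mul, pow_add]
        _ ≤ (q * #(A z)) ^ n * (q * #(B z)) ^ n := by gcongr
        _ = q ^ (2 * n) * (#(A z) ^ n * #(B z) ^ n) := by
          rw [mul_pow, mul_pow, two_mul, pow_add]; ring
        _ ≤ q ^ (2 * n) * ((4 * n) ^ (2 * n) * #(bipartiteAbove rel P z)) := by
          exact Nat.mul_le_mul_left _ (hgc.trans (Nat.mul_le_mul_left _ (by convert hle)))
        _ = _ := by rw [mul_pow _ q]; ring
    have hsum : #G * M ^ (2 * n) ≤ (4 * n * q) ^ (2 * n) * (M ^ (2 * n) * n) := by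
      calc #G * M ^ (2 * n) ≤ ∑ z ∈ G, (4 * n * q) ^ (2 * n) * #(bipartiteAbove rel P z) := by
            rw [← smul_eq_mul]; exact card_nsmul_le_sum _ _ _ hlow
        _ = (4 * n * q) ^ (2 * n) * ∑ p ∈ P, #(bipartiteBelow rel G p) := by
            rw [← mul_sum, hdc]
        _ ≤ _ := by gcongr
    have h3 : #G ≤ (4 * n * q) ^ (2 * n) * n := by
      apply Nat.le_of_mul_le_mul_right _ (show 0 < M ^ (2 * n) by positivity)
      linarith
    have h4 : q * #G ≤ (4 * n * q) ^ (2 * n + 1) := by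
      calc q * #G ≤ q * ((4 * n * q) ^ (2 * n) * n) := by gcongr
        _ ≤ 4 * (q * ((4 * n * q) ^ (2 * n) * n)) := by omega
        _ = _ := by rw [pow_succ]; ring
    omega
  have hpt : ∀ z, q * (#(A z) * #(B z)) ≤ (M ^ 2 + 4 * n * q * r z) + if z ∈ G then q * M ^ 2 else 0 := by
    intro z
    split_ifs with hz
    · have : #(A z) * #(B z) ≤ M ^ 2 := by rw [pow_two]; exact Nat.mul_le_mul (hAM z) (hBM z)
      have := Nat.mul_le_mul_left q this
      omega
    · simp only [hG, mem_filter, mem_univ, true_and, not_and_or, not_lt] at hz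
      rcases hz with hz | hz
      · omega
      · have := Nat.mul_le_mul_left q hz
        have e : q * (4 * n * r z) = 4 * n * q * r z := by ring
        omega
  calc q * ∑ z, #(A z) * #(B z) = ∑ z, q * (#(A z) * #(B z)) := by rw [mul_sum]
    _ ≤ ∑ z, ((M ^ 2 + 4 * n * q * r z) + if z ∈ G then q * M ^ 2 else 0) :=
        sum_le_sum fun z _ => hpt z
    _ = M * M ^ 2 + 4 * n * q * ∑ z, r z + (q * #G) * M ^ 2 := by
        rw [sum_add_distrib, sum_add_distrib, ← mul_sum]
        simp [hMdef]; ring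
    _ ≤ M * M ^ 2 + 4 * n * q * ∑ z, r z + M * M ^ 2 := by gcongr
    _ = _ := by ring

lemma sum_update {V α : Type*} [Fintype V] [DecidableEq V] [Fintype α] (u : V)
    (F : (V → α) → ℕ) :
    ∑ f : V → α, ∑ x, F (Function.update f u x) = Fintype.card α * ∑ f, F f := by
  rw [← Fintype.sum_prod_type']
  have e : Function.Involutive (fun p : (V → α) × α => (Function.update p.1 u p.2, p.1 u)) := by
    rintro ⟨f, x⟩
    simp
  rw [Fintype.sum_equiv e.toPerm _ (fun p => F p.1) (by rintro ⟨f, x⟩; rfl),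
    Fintype.sum_prod_type]
  simp [mul_sum]

open Classical in
lemma global_count {V α : Type*} [Fintype V] [DecidableEq V] [Fintype α] [Nonempty α] (n q : ℕ) (hn : 1 ≤ n) (hq : 1 ≤ q)
    (hM : (4 * n * q) ^ (2 * n + 1) ≤ Fintype.card α)
    (u v w : V) (huv : u ≠ v) (huw : u ≠ w) (hvw : v ≠ w)
    (P Q : (V → α) → Prop)
    (hP : ∀ f y, P (Function.update f v y) ↔ P f)
    (hQ : ∀ f x, Q (Function.update f u x) ↔ Q f) (R : α → α → α → Prop)
    (hfree : ∀ X Y Z : Finset α, #X = n → #Y = n → #Z = n →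
      ∃ x ∈ X, ∃ y ∈ Y, ∃ z ∈ Z, R z x y) :
    q * #{f : V → α | P f ∧ Q f} ≤ 2 * Fintype.card α ^ Fintype.card V +
      4 * n * q * #{f : V → α | (P f ∧ Q f) ∧ R (f w) (f u) (f v)} := by
  set M := Fintype.card α with hMdef
  have hMpos : 0 < M := Fintype.card_pos
  have key : ∀ F : (V → α) → ℕ, M ^ 3 * ∑ f, F f = ∑ f : V → α, ∑ z, ∑ x, ∑ y,
      F (Function.update (Function.update (Function.update f w z) u x) v y) := by
    intro F
    rw [sum_update w (fun f => ∑ x, ∑ y, F (Function.update (Function.update f u x) v y)),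
      sum_update u (fun f => ∑ y, F (Function.update f v y)), sum_update v F]
    ring
  have hP' : ∀ f z x y, P (Function.update (Function.update (Function.update f w z) u x) v y) ↔
      P (Function.update (Function.update f w z) u x) := fun f z x y => hP _ _
  have hQ' : ∀ f z x y, Q (Function.update (Function.update (Function.update f w z) u x) v y) ↔
      Q (Function.update (Function.update f w z) v y) := fun f z x y => by
    rw [Function.update_comm huv]; exact hQ _ _
  have k1 := key (fun f => if P f ∧ Q f then 1 else 0)
  have k2 := key (fun f => if (P f ∧ Q f) ∧ R (f w) (f u) (f v) then 1 else 0)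
  have c1 : ∀ f : V → α, ∀ z, (∑ x, ∑ y, (fun f => if P f ∧ Q f then 1 else 0)
      (Function.update (Function.update (Function.update f w z) u x) v y)) =
      #{x | P (Function.update (Function.update f w z) u x)} *
      #{y | Q (Function.update (Function.update f w z) v y)} := by
    intro f z
    simp only [hP', hQ']
    rw [card_filter, card_filter, sum_mul_sum]
    refine sum_congr rfl fun x _ => sum_congr rfl fun y _ => ?_
    by_cases h1 : P (Function.update (Function.update f w z) u x) <;> simp [h1]
  have c2 : ∀ f : V → α, ∀ z, (∑ x, ∑ y, (fun f => if (P f ∧ Q f) ∧ R (f w) (f u) (f v) then 1 else 0)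
      (Function.update (Function.update (Function.update f w z) u x) v y)) =
      ∑ x ∈ ({x | P (Function.update (Function.update f w z) u x)} : Finset α),
      #{y ∈ ({y | Q (Function.update (Function.update f w z) v y)} : Finset α) | R z x y} := by
    intro f z
    simp only [hP', hQ']
    rw [sum_filter]
    refine sum_congr rfl fun x _ => ?_
    rw [filter_filter, card_filter]
    by_cases h1 : P (Function.update (Function.update f w z) u x) <;>
      simp [h1, huv, huw.symm, hvw.symm]
  simp only [c1] at k1
  simp only [c2] at k2
  rw [← card_filter] at k1 k2
  have := sum_le_sum (s := (univ : Finset (V → α))) fun f _ => local_count n q hn hq hM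
    (fun z => {x | P (Function.update (Function.update f w z) u x)})
    (fun z => {y | Q (Function.update (Function.update f w z) v y)}) R hfree
  rw [← mul_sum, sum_add_distrib, ← mul_sum, ← mul_sum, ← k1, ← k2] at this
  simp only [sum_const, card_univ, Fintype.card_fun, smul_eq_mul] at this
  apply Nat.le_of_mul_le_mul_left _ (show 0 < M ^ 3 by positivity)
  rw [← hMdef] at this
  linarith

lemma part_inj {M u v a b : ℕ} (ha : a < M) (hb : b < M) (h : u * M + a = v * M + b) :
    u = v ∧ a = b := by
  have hM : 0 < M := by omega
  have h1 : (u * M + a) / M = u := by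
    rw [mul_comm, Nat.mul_add_div hM, Nat.div_eq_of_lt ha, add_zero]
  have h2 : (v * M + b) / M = v := by
    rw [mul_comm, Nat.mul_add_div hM, Nat.div_eq_of_lt hb, add_zero]
  have h3 : u = v := by rw [← h1, ← h2, h]
  subst h3
  exact ⟨rfl, by omega⟩

lemma part_lt {M K u a : ℕ} (ha : a < M) (hu : u < K) : u * M + a < K * M := by
  have : (u + 1) * M ≤ K * M := Nat.mul_le_mul_right M hu
  linarith

lemma exists_enum {M n : ℕ} (X : Finset (Fin M)) (hX : #X = n) :
    ∃ g : ℕ → ℕ, (∀ i < n, ∃ x ∈ X, (x : ℕ) = g i) ∧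
      ∀ i < n, ∀ j < n, g i = g j → i = j := by
  refine ⟨fun i => if h : i < n then (X.orderEmbOfFin hX ⟨i, h⟩ : ℕ) else 0, ?_, ?_⟩
  · intro i hi
    exact ⟨_, X.orderEmbOfFin_mem hX ⟨i, hi⟩, by simp [hi]⟩
  · intro i hi j hj h
    simp only [hi, hj, dif_pos] at h
    have := (X.orderEmbOfFin hX).injective (Fin.ext h)
    simpa using this

lemma blue_copy {n M K : ℕ} (χ : Finset ℕ → Bool) {u v w : ℕ} (hu : u < K) (hv : v < K)
    (hw : w < K) (huv : u ≠ v) (huw : u ≠ w) (hvw : v ≠ w) (X Y Z : Finset (Fin M))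
    (hX : #X = n) (hY : #Y = n) (hZ : #Z = n)
    (h : ∀ x ∈ X, ∀ y ∈ Y, ∀ z ∈ Z,
      χ {u * M + (x : ℕ), v * M + (y : ℕ), w * M + (z : ℕ)} = false) :
    hasMonoCopy (K * M) χ (tripartite n n n) false := by
  obtain ⟨gX, hX1, hX2⟩ := exists_enum X hX
  obtain ⟨gY, hY1, hY2⟩ := exists_enum Y hY
  obtain ⟨gZ, hZ1, hZ2⟩ := exists_enum Z hZ
  have lX : ∀ i < n, gX i < M := fun i hi => by
    obtain ⟨x, _, hx⟩ := hX1 i hi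
    rw [← hx]; exact x.2
  have lY : ∀ i < n, gY i < M := fun i hi => by
    obtain ⟨x, _, hx⟩ := hY1 i hi
    rw [← hx]; exact x.2
  have lZ : ∀ i < n, gZ i < M := fun i hi => by
    obtain ⟨x, _, hx⟩ := hZ1 i hi
    rw [← hx]; exact x.2
  let φ : ℕ → ℕ := fun i => if i < n then u * M + gX i else
    if i < n + n then v * M + gY (i - n) else w * M + gZ (i - (n + n))
  have φ1 : ∀ i, i < n → φ i = u * M + gX i := fun i hi => by simp [φ, hi]
  have φ2 : ∀ i, n ≤ i → i < n + n → φ i = v * M + gY (i - n) := fun i hi hi' => by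
    simp [φ, hi', not_lt.2 hi]
  have φ3 : ∀ i, n + n ≤ i → φ i = w * M + gZ (i - (n + n)) := fun i hi => by
    have : ¬ i < n := by omega
    simp [φ, not_lt.2 hi, this]
  refine ⟨φ, ?_, ?_, ?_⟩
  · intro i hi j hj hij
    simp only [tripartite, coe_range, Set.mem_Iio] at hi hj
    have ci : i < n ∨ (n ≤ i ∧ i < n + n) ∨ n + n ≤ i := by omega
    have cj : j < n ∨ (n ≤ j ∧ j < n + n) ∨ n + n ≤ j := by omega
    rcases ci with ci | ci | ci <;> rcases cj with cj | cj | cj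
    · rw [φ1 i ci, φ1 j cj] at hij
      exact hX2 i ci j cj (part_inj (lX i ci) (lX j cj) hij).2
    · rw [φ1 i ci, φ2 j cj.1 cj.2] at hij
      exact absurd (part_inj (lX i ci) (lY _ (by omega)) hij).1 huv
    · rw [φ1 i ci, φ3 j cj] at hij
      exact absurd (part_inj (lX i ci) (lZ _ (by omega)) hij).1 huw
    · rw [φ2 i ci.1 ci.2, φ1 j cj] at hij
      exact absurd (part_inj (lY _ (by omega)) (lX _ cj) hij).1 huv.symm
    · rw [φ2 i ci.1 ci.2, φ2 j cj.1 cj.2] at hij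
      have := hY2 (i - n) (by omega) (j - n) (by omega)
        (part_inj (lY _ (by omega)) (lY _ (by omega)) hij).2
      omega
    · rw [φ2 i ci.1 ci.2, φ3 j cj] at hij
      exact absurd (part_inj (lY _ (by omega)) (lZ _ (by omega)) hij).1 hvw
    · rw [φ3 i ci, φ1 j cj] at hij
      exact absurd (part_inj (lZ _ (by omega)) (lX _ cj) hij).1 huw.symm
    · rw [φ3 i ci, φ2 j cj.1 cj.2] at hij
      exact absurd (part_inj (lZ _ (by omega)) (lY _ (by omega)) hij).1 hvw.symm
    · rw [φ3 i ci, φ3 j cj] at hij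
      have := hZ2 (i - (n + n)) (by omega) (j - (n + n)) (by omega)
        (part_inj (lZ _ (by omega)) (lZ _ (by omega)) hij).2
      omega
  · intro i hi
    simp only [tripartite, mem_range] at hi
    have ci : i < n ∨ (n ≤ i ∧ i < n + n) ∨ n + n ≤ i := by omega
    rcases ci with ci | ci | ci
    · rw [φ1 i ci]; exact part_lt (lX i ci) hu
    · rw [φ2 i ci.1 ci.2]; exact part_lt (lY _ (by omega)) hv
    · rw [φ3 i ci]; exact part_lt (lZ _ (by omega)) hw
  · intro e he
    simp only [tripartite, mem_filter, mem_powersetCard] at he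
    obtain ⟨⟨hsub, -⟩, h1, h2, h3⟩ := he
    obtain ⟨i, hi⟩ := card_eq_one.1 h1
    obtain ⟨j, hj⟩ := card_eq_one.1 h2
    obtain ⟨k, hk⟩ := card_eq_one.1 h3
    have mi := (Finset.ext_iff.1 hi)
    have mj := (Finset.ext_iff.1 hj)
    have mk := (Finset.ext_iff.1 hk)
    simp only [mem_filter, mem_singleton] at mi mj mk
    have hi' := (mi i).2 rfl
    have hj' := (mj j).2 rfl
    have hk' := (mk k).2 rfl
    have hk3 := mem_range.1 (hsub hk'.1)
    have hee : e = {i, j, k} := by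
      ext t
      simp only [mem_insert, mem_singleton]
      constructor
      · intro ht
        have ct : t < n ∨ (n ≤ t ∧ t < n + n) ∨ n + n ≤ t := by omega
        rcases ct with ct | ct | ct
        · exact Or.inl ((mi t).1 ⟨ht, ct⟩)
        · exact Or.inr (Or.inl ((mj t).1 ⟨ht, ct⟩))
        · exact Or.inr (Or.inr ((mk t).1 ⟨ht, ct⟩))
      · rintro (rfl | rfl | rfl)
        · exact hi'.1
        · exact hj'.1
        · exact hk'.1
    rw [hee]
    simp only [image_insert, image_singleton]
    rw [φ1 i hi'.2, φ2 j hj'.2.1 hj'.2.2, φ3 k hk'.2]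
    obtain ⟨x, hx, ex⟩ := hX1 i hi'.2
    obtain ⟨y, hy, ey⟩ := hY1 (j - n) (by omega)
    obtain ⟨z, hz, ez⟩ := hZ1 (k - (n + n)) (by omega)
    rw [← ex, ← ey, ← ez]
    exact h x hx y hy z hz

/-- The embedding of the vertices `< K` into `K` blocks of size `M` given by `f`. -/
def blockEmb (K M : ℕ) (f : Fin K → Fin M) (v : ℕ) : ℕ :=
  if h : v < K then v * M + (f ⟨v, h⟩ : ℕ) else 0

lemma blockEmb_update {K M : ℕ} (f : Fin K → Fin M) (u : Fin K) (x : Fin M) (e : Finset ℕ)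
    (hu : (u : ℕ) ∉ e) :
    e.image (blockEmb K M (Function.update f u x)) = e.image (blockEmb K M f) := by
  apply image_congr
  intro v hv
  unfold blockEmb
  split_ifs with h
  · rw [Function.update_of_ne]
    rintro rfl
    exact hu hv
  · rfl

open Classical in
lemma step_count (n K M : ℕ) (hn : 1 ≤ n) (hMpos : 0 < M) (χ : Finset ℕ → Bool)
    (hno : ¬ hasMonoCopy (K * M) χ (tripartite n n n) false)
    (l : List (Finset ℕ)) (hc : ∀ e ∈ l, e.card = 3) (hs : ∀ e ∈ l, e ⊆ range K)
    (hord : ∀ i : Fin l.length, ∃ p : Finset ℕ, p.card = 2 ∧ p ⊆ l.get i ∧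
        ∀ j : Fin l.length, j < i → ¬ p ⊆ l.get j)
    (hM : (16 * n * (8 * n) ^ l.length) ^ (2 * n + 1) ≤ M) (k : ℕ) (hk : k ≤ l.length) :
    M ^ K ≤ (8 * n) ^ k * #{f : Fin K → Fin M | ∀ j : Fin l.length, (j : ℕ) < k →
      χ ((l.get j).image (blockEmb K M f)) = true} := by
  have : Nonempty (Fin M) := ⟨⟨0, hMpos⟩⟩
  induction k with
  | zero => simp
  | succ k ih =>
    have ih := ih (by omega)
    obtain ⟨p, hp2, hpe, hpn⟩ := hord ⟨k, hk⟩
    set e := l.get ⟨k, hk⟩ with he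
    have hel : e ∈ l := List.get_mem _ _
    obtain ⟨u, v, huv, rfl⟩ := card_eq_two.1 hp2
    have h1 : #(e \ {u, v}) = 1 := by
      rw [card_sdiff_of_subset hpe, hc e hel, hp2]
    obtain ⟨w, hw⟩ := card_eq_one.1 h1
    have hwm : w ∈ e \ {u, v} := by rw [hw]; simp
    simp only [mem_sdiff, mem_insert, mem_singleton, not_or] at hwm
    have hee : e = {u, v, w} := by
      rw [← sdiff_union_of_subset hpe, hw]
      ext t; simp; tauto
    have hu : u < K := mem_range.1 (hs e hel (hpe (by simp)))
    have hv : v < K := mem_range.1 (hs e hel (hpe (by simp)))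
    have hwK : w < K := mem_range.1 (hs e hel hwm.1)
    let P : (Fin K → Fin M) → Prop := fun f => ∀ j : Fin l.length, (j : ℕ) < k → v ∉ l.get j →
      χ ((l.get j).image (blockEmb K M f)) = true
    let Q : (Fin K → Fin M) → Prop := fun f => ∀ j : Fin l.length, (j : ℕ) < k → u ∉ l.get j →
      χ ((l.get j).image (blockEmb K M f)) = true
    let R : Fin M → Fin M → Fin M → Prop := fun z x y =>
      χ {u * M + (x : ℕ), v * M + (y : ℕ), w * M + (z : ℕ)} = true
    have hPQ : ∀ f, (P f ∧ Q f) ↔ ∀ j : Fin l.length, (j : ℕ) < k →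
        χ ((l.get j).image (blockEmb K M f)) = true := by
      intro f
      constructor
      · rintro ⟨hP, hQ⟩ j hj
        by_cases hvj : v ∈ l.get j
        · by_cases huj : u ∈ l.get j
          · refine absurd ?_ (hpn j hj)
            intro t ht
            simp only [mem_insert, mem_singleton] at ht
            rcases ht with rfl | rfl <;> assumption
          · exact hQ j hj huj
        · exact hP j hj hvj
      · intro h
        exact ⟨fun j hj _ => h j hj, fun j hj _ => h j hj⟩
    have hR : ∀ f : Fin K → Fin M, R (f ⟨w, hwK⟩) (f ⟨u, hu⟩) (f ⟨v, hv⟩) ↔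
        χ (e.image (blockEmb K M f)) = true := by
      intro f
      rw [hee]
      simp only [image_insert, image_singleton, R, blockEmb, hu, hv, hwK, dif_pos]
    set D := (8 * n) ^ k with hD
    have hDpos : 1 ≤ D := Nat.one_le_pow _ _ (by omega)
    have hDle : D ≤ (8 * n) ^ l.length := Nat.pow_le_pow_right (by omega) (by omega)
    have hg := global_count (V := Fin K) (α := Fin M) n (4 * D) hn (by omega)
      (by
        rw [Fintype.card_fin]
        refine le_trans (Nat.pow_le_pow_left ?_ _) hM
        calc 4 * n * (4 * D) = 16 * n * D := by ring
          _ ≤ _ := Nat.mul_le_mul_left _ hDle)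
      ⟨u, hu⟩ ⟨v, hv⟩ ⟨w, hwK⟩ (by simpa using huv)
      (by simpa using Ne.symm hwm.2.1) (by simpa using Ne.symm hwm.2.2) P Q
      (fun f y => by
        refine forall_congr' fun j => forall_congr' fun _ => forall_congr' fun hj => ?_
        rw [blockEmb_update f ⟨v, hv⟩ y _ hj])
      (fun f x => by
        refine forall_congr' fun j => forall_congr' fun _ => forall_congr' fun hj => ?_
        rw [blockEmb_update f ⟨u, hu⟩ x _ hj]) R
      (by
        intro X Y Z hX hY hZ
        by_contra hcon
        push Not at hcon
        apply hno
        refine blue_copy χ hu hv hwK huv (Ne.symm hwm.2.1) (Ne.symm hwm.2.2) X Y Z hX hY hZ ?_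
        intro x hx y hy z hz
        have := hcon x hx y hy z hz
        simpa [R] using this)
    simp only [hPQ, hR, Fintype.card_fin] at hg
    have hset : ∀ f : Fin K → Fin M, ((∀ j : Fin l.length, (j : ℕ) < k →
        χ ((l.get j).image (blockEmb K M f)) = true) ∧ χ (e.image (blockEmb K M f)) = true) ↔
        ∀ j : Fin l.length, (j : ℕ) < k + 1 →
        χ ((l.get j).image (blockEmb K M f)) = true := by
      intro f
      constructor
      · rintro ⟨h1, h2⟩ j hj
        rcases Nat.lt_succ_iff_lt_or_eq.1 hj with h | h
        · exact h1 j h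
        · have : j = ⟨k, hk⟩ := Fin.ext h
          rw [this]; exact h2
      · intro h
        exact ⟨fun j hj => h j (by omega), h ⟨k, hk⟩ (by simp)⟩
    simp only [hset] at hg
    set a := #{f : Fin K → Fin M | ∀ j : Fin l.length, (j : ℕ) < k →
        χ ((l.get j).image (blockEmb K M f)) = true}
    set b := #{f : Fin K → Fin M | ∀ j : Fin l.length, (j : ℕ) < k + 1 →
        χ ((l.get j).image (blockEmb K M f)) = true}
    have hg2 : 4 * D * a ≤ 2 * M ^ K + 4 * n * (4 * D) * b := by convert hg
    rw [pow_succ, ← hD]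
    have : 4 * n * (4 * D) * b = 2 * (D * (8 * n) * b) := by ring
    have h4 : 4 * D * a = 4 * (D * a) := by ring
    omega

lemma mem_ramsey (H : ThreeGraph) (l : List (Finset ℕ)) (hl : l.toFinset = H.edges)
    (hord : ∀ i : Fin l.length, ∃ p : Finset ℕ, p.card = 2 ∧ p ⊆ l.get i ∧
        ∀ j : Fin l.length, j < i → ¬ p ⊆ l.get j) (K : ℕ) (hK : H.verts ⊆ range K)
    (n : ℕ) (hn : 1 ≤ n) :
    ramsey H (tripartite n n n) ≤ K * (16 * n * (8 * n) ^ l.length) ^ (2 * n + 1) := by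
  apply Nat.sInf_le
  intro χ
  set M := (16 * n * (8 * n) ^ l.length) ^ (2 * n + 1) with hM
  have hMpos : 0 < M := by positivity
  by_cases hno : hasMonoCopy (K * M) χ (tripartite n n n) false
  · exact Or.inr hno
  left
  have hmem : ∀ e ∈ l, e ∈ H.edges := fun e he => by rw [← hl]; simpa using he
  have hcount := step_count n K M hn hMpos χ hno l (fun e he => H.card_eq e (hmem e he))
    (fun e he => (H.subset_verts e (hmem e he)).trans hK) hord hM.le l.length le_rfl
  have hpos : 0 < M ^ K := by positivity
  have hne := pos_of_mul_pos_right (lt_of_lt_of_le hpos hcount) (Nat.zero_le _)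
  obtain ⟨f, hf⟩ := card_pos.1 hne
  simp only [mem_filter, mem_univ, true_and] at hf
  have hlt : ∀ v ∈ H.verts, v < K := fun v hv => mem_range.1 (hK hv)
  refine ⟨blockEmb K M f, ?_, ?_, ?_⟩
  · intro a ha b hb hab
    simp only [blockEmb, hlt a ha, hlt b hb, dif_pos] at hab
    exact (part_inj (Fin.is_lt _) (Fin.is_lt _) hab).1
  · intro v hv
    simp only [blockEmb, hlt v hv, dif_pos]
    exact part_lt (Fin.is_lt _) (hlt v hv)
  · intro e he
    rw [← hl, List.mem_toFinset] at he
    obtain ⟨j, rfl⟩ := List.get_of_mem he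
    exact hf j j.2

lemma final_bound (K m n : ℕ) (hn : 2 ≤ n) :
    ((K * (16 * n * (8 * n) ^ m) ^ (2 * n + 1) : ℕ) : ℝ) ≤
      (2 : ℝ) ^ (((K : ℝ) + 30 * (m + 1)) * n * Real.log n) := by
  have hn' : (2 : ℝ) ≤ n := by exact_mod_cast hn
  have hlog2 : (1 / 2 : ℝ) ≤ Real.log 2 := by have := Real.log_two_gt_d9; linarith
  have hlogn : Real.log 2 ≤ Real.log n := Real.log_le_log (by norm_num) hn'
  have hL : 1 ≤ n * Real.log n := by nlinarith
  have h1 : 16 * n * (8 * n) ^ m ≤ n ^ (5 * (m + 1)) := by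
    have h16 : 16 * n ≤ n ^ 5 := by
      have : 2 ^ 4 ≤ n ^ 4 := Nat.pow_le_pow_left hn 4
      rw [pow_succ]; gcongr; simpa using this
    calc 16 * n * (8 * n) ^ m ≤ n ^ 5 * (n ^ 5) ^ m := by
          gcongr; omega
      _ = _ := by rw [← pow_mul, ← pow_add]; ring_nf
  have h2 : (16 * n * (8 * n) ^ m) ^ (2 * n + 1) ≤ n ^ (15 * (m + 1) * n) := by
    calc _ ≤ (n ^ (5 * (m + 1))) ^ (3 * n) := by
          refine le_trans (Nat.pow_le_pow_left h1 _) (Nat.pow_le_pow_right ?_ (by omega))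
          positivity
      _ = _ := by rw [← pow_mul]; ring_nf
  have h3 : (n : ℝ) ^ (15 * (m + 1) * n) ≤ (2 : ℝ) ^ ((30 * ((m : ℝ) + 1)) * n * Real.log n) := by
    rw [← Real.rpow_natCast, Real.rpow_def_of_pos (by linarith), Real.rpow_def_of_pos (by norm_num)]
    apply Real.exp_le_exp.2
    push_cast
    have : 0 ≤ ((m : ℝ) + 1) * n * Real.log n := by
      have : 0 ≤ Real.log n := by linarith
      positivity
    nlinarith
  have h4 : (K : ℝ) ≤ (2 : ℝ) ^ ((K : ℝ) * n * Real.log n) := by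
    calc (K : ℝ) ≤ (2 : ℝ) ^ K := by exact_mod_cast Nat.lt_two_pow_self.le
      _ = (2 : ℝ) ^ (K : ℝ) := by rw [Real.rpow_natCast]
      _ ≤ _ := by
        apply Real.rpow_le_rpow_of_exponent_le (by norm_num)
        rw [mul_assoc]
        exact le_mul_of_one_le_right (Nat.cast_nonneg _) hL
  calc ((K * (16 * n * (8 * n) ^ m) ^ (2 * n + 1) : ℕ) : ℝ)
      ≤ (K : ℝ) * (n : ℝ) ^ (15 * (m + 1) * n) := by exact_mod_cast Nat.mul_le_mul_left K h2
    _ ≤ (2 : ℝ) ^ ((K : ℝ) * n * Real.log n) *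
        (2 : ℝ) ^ ((30 * ((m : ℝ) + 1)) * n * Real.log n) := by gcongr
    _ = _ := by rw [← Real.rpow_add (by norm_num)]; ring_nf

/-- If the edges of `H` can be ordered so that each edge contains a pair not
contained in any earlier edge, then `r(H, K_{n,n,n}^{(3)}) ≤ 2^{C n log n}`. -/
theorem ramsey_upper_of_shadow_increasing (H : ThreeGraph)
    (hord : ∃ l : List (Finset ℕ), l.Nodup ∧ l.toFinset = H.edges ∧
      ∀ i : Fin l.length, ∃ p : Finset ℕ, p.card = 2 ∧ p ⊆ l.get i ∧
        ∀ j : Fin l.length, j < i → ¬ p ⊆ l.get j) :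
    ∃ C : ℝ, C > 0 ∧ ∀ n : ℕ, 2 ≤ n →
      (ramsey H (tripartite n n n) : ℝ) ≤ (2 : ℝ) ^ (C * n * Real.log n) := by
  obtain ⟨l, -, hl, hord⟩ := hord
  refine ⟨((H.verts.sup id + 1 : ℕ) : ℝ) + 30 * ((l.length : ℝ) + 1), by positivity, ?_⟩
  intro n hn
  refine le_trans (Nat.cast_le.2 (mem_ramsey H l hl hord (H.verts.sup id + 1) ?_ n (by omega)))
    (final_bound _ l.length n hn)
  intro v hv
  rw [mem_range]
  exact Nat.lt_succ_of_le (le_sup (f := id) hv)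
end
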